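/- Let m ≥ 2, let 1 < q⃗_i < ∞ for i = 1,…,m, let 1/q⃗ = 1/q⃗_1 + ⋯ + 1/q⃗_m (componentwise), and let φ, φ_1,…,φ_m : ℝ^n × (0,∞) → (0,∞) be Lebesgue measurable functions satisfying, for some constant C_0 and all x ∈ ℝ^n, r > 0: Π_{i=1}^m ∫_r^∞ φ_i(x,t)·t^{−1} dt ≤ C_0 · φ(x,r). Then the multi-sublinear maximal operator M_m is bounded from M^{φ_1}_{q⃗_1}(ℝ^n)×⋯×M^{φ_m}_{q⃗_m}(ℝ^n) to M^{φ}_{q⃗}(ℝ^n): there is C > 0 such that ‖M_m(f⃗)‖_{M^φ_{q⃗}} ≤ C Π_{i=1}^m ‖f_i‖_{M^{φ_i}_{q⃗_i}} for all f_i ∈ M^{φ_i}_{q⃗_i}(ℝ^n). -/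

import Mathlib

open MeasureTheory ENNReal Set

noncomputable section

/-- Euclidean distance on `Fin n → ℝ`. -/
def eudist (n : ℕ) (x y : Fin n → ℝ) : ℝ :=
  Real.sqrt (∑ i, (x i - y i) ^ 2)

/-- Open Euclidean ball in `Fin n → ℝ`. -/
def eball (n : ℕ) (x : Fin n → ℝ) (r : ℝ) : Set (Fin n → ℝ) :=
  {y | eudist n x y < r}

/-- Iterated mixed Lebesgue "norm" of an `ℝ≥0∞`-valued function: the innermost
integration is in the first coordinate with exponent `q 0`, the outermost in the
last coordinate with exponent `q (n-1)`. -/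
def mixedLnorm : (n : ℕ) → (Fin n → ℝ) → ((Fin n → ℝ) → ℝ≥0∞) → ℝ≥0∞
  | 0, _, g => g (fun i => i.elim0)
  | (n + 1), q, g =>
      (∫⁻ t : ℝ, (mixedLnorm n (fun i => q i.castSucc)
          (fun y => g (Fin.snoc y t))) ^ q (Fin.last n)) ^ (1 / q (Fin.last n))

/-- Mixed Lebesgue norm `‖f‖_{L^{q⃗}}` of a real-valued function on `ℝ^n`. -/
def mixedNorm (n : ℕ) (q : Fin n → ℝ) (f : (Fin n → ℝ) → ℝ) : ℝ≥0∞ :=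
  mixedLnorm n q (fun x => ENNReal.ofReal |f x|)

/-- Generalized mixed Morrey norm of an `ℝ≥0∞`-valued function. -/
def morreyLnorm (n : ℕ) (q : Fin n → ℝ) (φ : (Fin n → ℝ) → ℝ → ℝ)
    (g : (Fin n → ℝ) → ℝ≥0∞) : ℝ≥0∞ :=
  ⨆ (x : Fin n → ℝ) (r : ℝ) (_ : 0 < r),
    (ENNReal.ofReal (φ x r))⁻¹
      * (mixedNorm n q ((eball n x r).indicator fun _ => (1 : ℝ)))⁻¹
      * mixedLnorm n q ((eball n x r).indicator g)

/-- Generalized mixed Morrey norm `‖f‖_{M^φ_{q⃗}}` of a real-valued function. -/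
def morreyNorm (n : ℕ) (q : Fin n → ℝ) (φ : (Fin n → ℝ) → ℝ → ℝ)
    (f : (Fin n → ℝ) → ℝ) : ℝ≥0∞ :=
  morreyLnorm n q φ (fun x => ENNReal.ofReal |f x|)

/-- The BMO norm (as an extended real number). -/
def bmoNorm (n : ℕ) (b : (Fin n → ℝ) → ℝ) : ℝ≥0∞ :=
  ⨆ (x : Fin n → ℝ) (r : ℝ) (_ : 0 < r),
    ENNReal.ofReal ((volume (eball n x r)).toReal⁻¹
      * ∫ y in eball n x r, |b y - ⨍ z in eball n x r, b z|)

/-- Sublinearity in each entry of a multi-(sub)linear operator. -/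
def EntrywiseSublinear (n m : ℕ)
    (T : (Fin m → ((Fin n → ℝ) → ℝ)) → ((Fin n → ℝ) → ℝ)) : Prop :=
  (∀ (f : Fin m → ((Fin n → ℝ) → ℝ)) (i : Fin m) (g h : (Fin n → ℝ) → ℝ)
      (x : Fin n → ℝ),
      |T (Function.update f i (g + h)) x|
        ≤ |T (Function.update f i g) x| + |T (Function.update f i h) x|) ∧
  (∀ (f : Fin m → ((Fin n → ℝ) → ℝ)) (i : Fin m) (c : ℝ) (g : (Fin n → ℝ) → ℝ)
      (x : Fin n → ℝ),
      |T (Function.update f i (c • g)) x| = |c| * |T (Function.update f i g) x|)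

/-- The multi-sublinear size condition (1.1) with constant `C`. -/
def SizeCond (n m : ℕ)
    (T : (Fin m → ((Fin n → ℝ) → ℝ)) → ((Fin n → ℝ) → ℝ)) (C : ℝ) : Prop :=
  ∀ f : Fin m → ((Fin n → ℝ) → ℝ),
    (∀ i, Integrable (f i)) → (∀ i, HasCompactSupport (f i)) →
    ∀ x, x ∉ ⋂ j, Function.support (f j) →
      |T f x| ≤ C * ∫ y : Fin m → (Fin n → ℝ),
        (∏ i, |f i (y i)|) / Real.sqrt (∑ i, eudist n x (y i) ^ 2) ^ (m * n)

/-- The multi-sublinear commutator size condition (1.2), with symbol `b` and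
distinguished index `i`, with constant `C`. -/
def CommSizeCond (n m : ℕ) (b : (Fin n → ℝ) → ℝ) (i : Fin m)
    (T : (Fin m → ((Fin n → ℝ) → ℝ)) → ((Fin n → ℝ) → ℝ)) (C : ℝ) : Prop :=
  ∀ f : Fin m → ((Fin n → ℝ) → ℝ),
    (∀ k, Integrable (f k)) → (∀ k, HasCompactSupport (f k)) →
    ∀ x, x ∉ ⋂ j, Function.support (f j) →
      |T f x| ≤ C * ∫ y : Fin m → (Fin n → ℝ),
        |b x - b (y i)| * (∏ k, |f k (y k)|)
          / Real.sqrt (∑ k, eudist n x (y k) ^ 2) ^ (m * n)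

/-- The Hardy–Littlewood maximal operator. -/
def hlMax (n : ℕ) (f : (Fin n → ℝ) → ℝ) (x : Fin n → ℝ) : ℝ≥0∞ :=
  ⨆ (r : ℝ) (_ : 0 < r),
    (volume (eball n x r))⁻¹ * ∫⁻ y in eball n x r, ENNReal.ofReal |f y|

/-- The maximal commutator of the Hardy–Littlewood maximal operator. -/
def maxComm (n : ℕ) (b f : (Fin n → ℝ) → ℝ) (x : Fin n → ℝ) : ℝ≥0∞ :=
  ⨆ (r : ℝ) (_ : 0 < r),
    (volume (eball n x r))⁻¹
      * ∫⁻ y in eball n x r, ENNReal.ofReal (|b x - b y| * |f y|)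

/-- The multi-sublinear maximal operator `M_m`. -/
def multiMax (n m : ℕ) (f : Fin m → ((Fin n → ℝ) → ℝ)) (x : Fin n → ℝ) : ℝ≥0∞ :=
  ⨆ (r : ℝ) (_ : 0 < r),
    ∏ i, (volume (eball n x r))⁻¹ * ∫⁻ y in eball n x r, ENNReal.ofReal |f i y|

/-- The multi-sublinear maximal commutator `M^{b⃗}_{m,i}`. -/
def multiMaxComm (n m : ℕ) (b : Fin m → ((Fin n → ℝ) → ℝ)) (i : Fin m)
    (f : Fin m → ((Fin n → ℝ) → ℝ)) (x : Fin n → ℝ) : ℝ≥0∞ :=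
  (⨆ (r : ℝ) (_ : 0 < r),
      (volume (eball n x r))⁻¹
        * ∫⁻ y in eball n x r, ENNReal.ofReal (|b i x - b i y| * |f i y|)) *
  (⨆ (r : ℝ) (_ : 0 < r),
      ∏ k ∈ Finset.univ.erase i,
        (volume (eball n x r))⁻¹ * ∫⁻ y in eball n x r, ENNReal.ofReal |f k y|)

/-- `w` is an `A₁` weight with constant `c`. -/
def IsA1Weight (n : ℕ) (w : (Fin n → ℝ) → ℝ) (c : ℝ) : Prop :=
  (∀ x, 0 < w x) ∧ LocallyIntegrable w ∧
    ∀ (x : Fin n → ℝ) (r : ℝ), 0 < r →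
      ∀ᵐ y ∂(volume.restrict (eball n x r)),
        (volume (eball n x r)).toReal⁻¹ * ∫ z in eball n x r, w z ≤ c * w y

/-- `T` is an `m`-linear Calderón–Zygmund operator. -/
def IsCZOperator (n m : ℕ)
    (T : (Fin m → ((Fin n → ℝ) → ℝ)) → ((Fin n → ℝ) → ℝ)) : Prop :=
  -- additivity in each entry
  (∀ (f : Fin m → ((Fin n → ℝ) → ℝ)) (i : Fin m) (g h : (Fin n → ℝ) → ℝ),
      T (Function.update f i (g + h))
        = T (Function.update f i g) + T (Function.update f i h)) ∧
  -- homogeneity in each entry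
  (∀ (f : Fin m → ((Fin n → ℝ) → ℝ)) (i : Fin m) (c : ℝ) (g : (Fin n → ℝ) → ℝ),
      T (Function.update f i (c • g)) = c • T (Function.update f i g)) ∧
  -- boundedness from a product of Lebesgue spaces
  (∃ (s : Fin m → ℝ) (s₀ A : ℝ), (∀ i, 1 ≤ s i) ∧ 0 < s₀ ∧
      (1 / s₀ = ∑ i, 1 / s i) ∧ 0 < A ∧
      ∀ f : Fin m → ((Fin n → ℝ) → ℝ), (∀ i, Measurable (f i)) →
        (∀ i, mixedNorm n (fun _ => s i) (f i) ≠ ⊤) →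
        mixedNorm n (fun _ => s₀) (T f)
          ≤ ENNReal.ofReal A * ∏ i, mixedNorm n (fun _ => s i) (f i)) ∧
  -- Calderón–Zygmund kernel and representation
  (∃ (K : (Fin n → ℝ) → (Fin m → (Fin n → ℝ)) → ℝ) (ε C : ℝ), 0 < ε ∧ 0 < C ∧
      -- size estimate
      (∀ x y, ¬(∀ k, y k = x) →
        |K x y| ≤ C / (∑ k, eudist n x (y k)) ^ (m * n)) ∧
      -- regularity in the first variable
      (∀ x x' y, ¬(∀ k, y k = x) →
        2 * eudist n x x' ≤ (⨆ k, eudist n x (y k)) →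
        |K x y - K x' y|
          ≤ C * eudist n x x' ^ ε / (∑ k, eudist n x (y k)) ^ ((m * n : ℝ) + ε)) ∧
      -- regularity in each of the remaining variables
      (∀ x y (k : Fin m) (y' : Fin n → ℝ), ¬(∀ j, y j = x) →
        2 * eudist n (y k) y' ≤ (⨆ j, eudist n x (y j)) →
        |K x y - K x (Function.update y k y')|
          ≤ C * eudist n (y k) y' ^ ε / (∑ j, eudist n x (y j)) ^ ((m * n : ℝ) + ε)) ∧
      -- integral representation off the supports
      (∀ f : Fin m → ((Fin n → ℝ) → ℝ),
        (∀ j, Measurable (f j)) → (∀ j, ∃ M : ℝ, ∀ x, |f j x| ≤ M) →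
        (∀ j, HasCompactSupport (f j)) →
        ∀ x, x ∉ ⋂ j, Function.support (f j) →
          T f x = ∫ y : Fin m → (Fin n → ℝ), K x y * ∏ j, f j (y j)))

/-- The commutator `K^{b⃗}_{m,i}` of an `m`-linear operator. -/
def czComm (n m : ℕ) (T : (Fin m → ((Fin n → ℝ) → ℝ)) → ((Fin n → ℝ) → ℝ))
    (b : Fin m → ((Fin n → ℝ) → ℝ)) (i : Fin m)
    (f : Fin m → ((Fin n → ℝ) → ℝ)) : (Fin n → ℝ) → ℝ :=
  fun x => b i x * T f x - T (Function.update f i fun y => b i y * f i y) x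

theorem aux_min_tendsto (a : ℝ≥0∞) :
    Filter.Tendsto (fun n : ℕ => min a (n : ℝ≥0∞)) Filter.atTop (nhds a) := by
  have h := (tendsto_const_nhds (x := a) (f := Filter.atTop (α := ℕ))).min
    ENNReal.tendsto_nat_nhds_top
  simpa using h

theorem lp_minkowski {T : Type} [MeasurableSpace T] (μ : Measure T) [SFinite μ]
    (q : ℝ) (hq : 1 ≤ q) (F : T → ℝ → ℝ≥0∞) (hF : Measurable (Function.uncurry F)) :
    (∫⁻ u : ℝ, (∫⁻ t, F t u ∂μ) ^ q) ^ (1 / q)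
      ≤ ∫⁻ t, (∫⁻ u : ℝ, F t u ^ q) ^ (1 / q) ∂μ := by
  rcases hq.eq_or_lt with h1 | h1
  · subst h1
    simp only [ENNReal.rpow_one, div_one]
    rw [lintegral_lintegral_swap]
    exact (hF.comp measurable_swap).aemeasurable
  have hq0 : 0 < q := by linarith
  set H : ℝ → ℝ≥0∞ := fun u => ∫⁻ t, F t u ∂μ with hH
  have hHm : Measurable H := by
    have := (hF.comp measurable_swap).lintegral_prod_right' (ν := μ)
    simpa using this
  set A : ℝ≥0∞ := ∫⁻ t, (∫⁻ u : ℝ, F t u ^ q) ^ (1 / q) ∂μ with hA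
  let q' := q.conjExponent
  have hc : q.HolderConjugate q' := Real.HolderConjugate.conjExponent h1
  -- the truncations
  have key : ∀ h : ℝ → ℝ≥0∞, Measurable h → h ≤ H → ∫⁻ u, h u ^ q ≠ ⊤ →
      ∫⁻ u, h u ^ q ≤ A ^ q := by
    intro h hm hle hfin
    set S := ∫⁻ u, h u ^ q with hS
    by_cases hS0 : S = 0
    · rw [hS0]; exact zero_le
    have hqq : (q - 1) * q' = q := by
      have := hc.sub_one_mul_conj
      linarith
    have e1 : S ≤ A * S ^ (1 / q') := by
      calc S = ∫⁻ u, h u * h u ^ (q - 1) := by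
            apply lintegral_congr; intro u
            have : q = 1 + (q - 1) := by ring
            conv_lhs => rw [this]
            rw [ENNReal.rpow_add_of_nonneg _ _ (by norm_num) (by linarith), ENNReal.rpow_one]
        _ ≤ ∫⁻ u, H u * h u ^ (q - 1) := by
            apply lintegral_mono; intro u; exact mul_le_mul_left (hle u) _
        _ = ∫⁻ u, ∫⁻ t, F t u * h u ^ (q - 1) ∂μ := by
            apply lintegral_congr; intro u
            rw [lintegral_mul_const]
            exact hF.comp (measurable_id.prodMk measurable_const)
        _ = ∫⁻ t, (∫⁻ u : ℝ, F t u * h u ^ (q - 1)) ∂μ := by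
            rw [lintegral_lintegral_swap]
            apply Measurable.aemeasurable
            exact (hF.comp measurable_swap).mul ((hm.comp measurable_fst).pow_const _)
        _ ≤ ∫⁻ t, (∫⁻ u : ℝ, F t u ^ q) ^ (1 / q) * S ^ (1 / q') ∂μ := by
            apply lintegral_mono; intro t
            have := ENNReal.lintegral_mul_le_Lp_mul_Lq volume hc (f := F t)
              (g := fun u => h u ^ (q - 1))
              (hF.comp (measurable_const.prodMk measurable_id)).aemeasurable
              (hm.pow_const _).aemeasurable
            refine this.trans ?_
            simp only [← ENNReal.rpow_mul, hqq]
            exact le_rfl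
        _ = A * S ^ (1 / q') := by
            rw [lintegral_mul_const]
            apply Measurable.pow_const
            exact Measurable.lintegral_prod_right' (f := fun z : T × ℝ => F z.1 z.2 ^ q)
              (hF.pow_const _)
    have e2 : S ^ (1 / q) ≤ A := by
      have h3 : S = S ^ (1 / q) * S ^ (1 / q') := by
        rw [← ENNReal.rpow_add _ _ hS0 hfin]
        have := hc.inv_add_inv_eq_one
        rw [one_div, one_div, this, ENNReal.rpow_one]
      have h4 : S ^ (1 / q') ≠ 0 := by
        simp [hS0, hfin]
      have h5 : S ^ (1 / q') ≠ ⊤ := by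
        apply ENNReal.rpow_ne_top_of_nonneg _ hfin
        have := hc.symm.pos; positivity
      have h6 : S ^ (1 / q) * S ^ (1 / q') ≤ A * S ^ (1 / q') := by
        rw [← h3]; exact e1
      exact (ENNReal.mul_le_mul_iff_left h4 h5).1 h6
    calc S = (S ^ (1 / q)) ^ q := by
          rw [← ENNReal.rpow_mul]; simp [hq0.ne']
      _ ≤ A ^ q := ENNReal.rpow_le_rpow e2 hq0.le
  have main : ∫⁻ u, H u ^ q ≤ A ^ q := by
    let h : ℕ → ℝ → ℝ≥0∞ := fun n => (Icc (-(n : ℝ)) n).indicator fun u => min (H u) n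
    have hm : ∀ n, Measurable (h n) := fun n =>
      (hHm.min measurable_const).indicator measurableSet_Icc
    have ht : Filter.Tendsto (fun n => ∫⁻ u, h n u ^ q) Filter.atTop (nhds (∫⁻ u, H u ^ q)) := by
      apply lintegral_tendsto_of_tendsto_of_monotone
      · intro n; exact ((hm n).pow_const _).aemeasurable
      · refine Filter.Eventually.of_forall fun u a b hab => ?_
        apply ENNReal.rpow_le_rpow _ hq0.le
        have hab' : (a : ℝ) ≤ b := by exact_mod_cast hab
        simp only [h]
        refine (indicator_le_indicator_of_subset (Icc_subset_Icc (neg_le_neg hab') hab')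
          (fun _ => zero_le) u).trans ?_
        apply indicator_le_indicator
        exact min_le_min_left _ (by exact_mod_cast hab)
      · refine Filter.Eventually.of_forall fun u => ?_
        apply (ENNReal.continuous_rpow_const.tendsto _).comp
        apply (aux_min_tendsto (H u)).congr'
        obtain ⟨N, hN⟩ := exists_nat_ge |u|
        filter_upwards [Filter.eventually_ge_atTop N] with n hn
        have : |u| ≤ n := hN.trans (by exact_mod_cast hn)
        simp only [h]
        rw [indicator_of_mem]
        exact abs_le.1 this
    refine le_of_tendsto' ht fun n => key _ (hm n) ?_ ?_
    · intro u
      exact (indicator_le_self _ _ u).trans (min_le_left _ _)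
    · apply ne_of_lt
      calc ∫⁻ u, h n u ^ q ≤ ∫⁻ u, (Icc (-(n : ℝ)) n).indicator (fun _ => (n : ℝ≥0∞) ^ q) u := by
            apply lintegral_mono; intro u
            by_cases hu : u ∈ Icc (-(n : ℝ)) n
            · simp only [h, indicator_of_mem hu]
              exact ENNReal.rpow_le_rpow (min_le_right _ _) hq0.le
            · simp only [h, indicator_of_notMem hu]
              simp [hq0]
        _ < ⊤ := by
            rw [lintegral_indicator measurableSet_Icc]
            simp only [lintegral_const, Measure.restrict_apply MeasurableSet.univ, univ_inter,
              Real.volume_Icc]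
            exact ENNReal.mul_lt_top (ENNReal.rpow_lt_top_of_nonneg hq0.le (by simp)) (by simp)
  calc (∫⁻ u : ℝ, H u ^ q) ^ (1 / q) ≤ (A ^ q) ^ (1 / q) :=
        ENNReal.rpow_le_rpow main (by positivity)
    _ = A := by rw [← ENNReal.rpow_mul]; simp [hq0.ne']

structure GoodNorm {Y : Type} [MeasurableSpace Y] (N : (Y → ℝ≥0∞) → ℝ≥0∞) : Prop where
  mono : ∀ f g : Y → ℝ≥0∞, f ≤ g → N f ≤ N g
  meas : ∀ (T : Type) [MeasurableSpace T] (f : T → Y → ℝ≥0∞),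
    Measurable (Function.uncurry f) → Measurable fun t => N (f t)
  mink : ∀ (T : Type) [MeasurableSpace T] (μ : Measure T) [SFinite μ] (f : T → Y → ℝ≥0∞),
    Measurable (Function.uncurry f) → N (fun y => ∫⁻ t, f t y ∂μ) ≤ ∫⁻ t, N (f t) ∂μ
  sup : ∀ f : ℕ → Y → ℝ≥0∞, Monotone f → (∀ k, Measurable (f k)) →
    N (fun y => ⨆ k, f k y) ≤ ⨆ k, N (f k)

theorem GoodNorm.add {Y : Type} [MeasurableSpace Y] {N : (Y → ℝ≥0∞) → ℝ≥0∞}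
    (h : GoodNorm N) (f g : Y → ℝ≥0∞) (hf : Measurable f) (hg : Measurable g) :
    N (fun y => f y + g y) ≤ N f + N g := by
  have := h.mink Bool Measure.count (fun b => if b then f else g) (by
    apply measurable_from_prod_countable_right
    intro b
    cases b <;> simp [Function.uncurry] <;> assumption)
  simpa [lintegral_count, tsum_bool, add_comm] using this

theorem GoodNorm.smul {Y : Type} [MeasurableSpace Y] {N : (Y → ℝ≥0∞) → ℝ≥0∞}
    (h : GoodNorm N) (c : ℝ≥0∞) (f : Y → ℝ≥0∞) (hf : Measurable f) :
    N (fun y => c * f y) ≤ c * N f := by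
  have := h.mink Unit (c • Measure.dirac ()) (fun _ => f) (hf.comp measurable_snd)
  simpa [mul_comm] using this

theorem measurable_snoc (n : ℕ) :
    Measurable fun z : (Fin n → ℝ) × ℝ => (Fin.snoc z.1 z.2 : Fin (n + 1) → ℝ) := by
  rw [measurable_pi_iff]
  intro i
  refine Fin.lastCases ?_ (fun j => ?_) i
  · simpa using measurable_snd
  · simpa [Function.comp_def] using (measurable_pi_apply j).comp measurable_fst

theorem mixedLnorm_zero (q : Fin 0 → ℝ) (g : (Fin 0 → ℝ) → ℝ≥0∞) :
    mixedLnorm 0 q g = g (fun i => i.elim0) := rfl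

theorem mixedLnorm_succ (n : ℕ) (q : Fin (n + 1) → ℝ) (g : (Fin (n + 1) → ℝ) → ℝ≥0∞) :
    mixedLnorm (n + 1) q g = (∫⁻ t : ℝ, (mixedLnorm n (fun i => q i.castSucc)
          (fun y => g (Fin.snoc y t))) ^ q (Fin.last n)) ^ (1 / q (Fin.last n)) := rfl

theorem mixedLnorm_mono (n : ℕ) (q : Fin n → ℝ) (hq : ∀ i, 0 < q i)
    (f g : (Fin n → ℝ) → ℝ≥0∞) (h : f ≤ g) : mixedLnorm n q f ≤ mixedLnorm n q g := by
  induction n with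
  | zero => exact h _
  | succ n ih =>
    simp only [mixedLnorm_succ]
    have := hq (Fin.last n)
    apply ENNReal.rpow_le_rpow _ (by positivity)
    apply lintegral_mono
    intro t
    apply ENNReal.rpow_le_rpow _ this.le
    exact ih _ (fun i => hq _) _ _ fun y => h _

theorem mixedLnorm_meas (n : ℕ) (q : Fin n → ℝ) (T : Type) [MeasurableSpace T]
    (f : T → (Fin n → ℝ) → ℝ≥0∞) (hf : Measurable (Function.uncurry f)) :
    Measurable fun t => mixedLnorm n q (f t) := by
  induction n generalizing T with
  | zero => exact hf.comp (measurable_id.prodMk measurable_const)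
  | succ n ih =>
    simp only [mixedLnorm_succ]
    apply Measurable.pow_const
    have := ih (fun i => q i.castSucc) (T × ℝ) (fun z y => f z.1 (Fin.snoc y z.2)) (by
      apply hf.comp (f := fun w : (T × ℝ) × (Fin n → ℝ) =>
        (w.1.1, (Fin.snoc w.2 w.1.2 : Fin (n + 1) → ℝ)))
      exact (measurable_fst.comp measurable_fst).prodMk
        ((measurable_snoc n).comp (measurable_snd.prodMk (measurable_snd.comp measurable_fst))))
    exact Measurable.lintegral_prod_right' (this.pow_const _)

theorem mixedLnorm_good (n : ℕ) (q : Fin n → ℝ) (hq : ∀ i, 1 ≤ q i) :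
    GoodNorm (mixedLnorm n q) := by
  have hq0 : ∀ i, 0 < q i := fun i => zero_lt_one.trans_le (hq i)
  refine ⟨mixedLnorm_mono n q hq0, mixedLnorm_meas n q, ?_, ?_⟩
  · induction n with
    | zero => intro T _ μ _ f hf; exact le_rfl
    | succ n ih =>
      intro T _ μ _ f hf
      simp only [mixedLnorm_succ]
      have h0 := hq0 (Fin.last n)
      have m1 : Measurable fun z : T × ℝ =>
          mixedLnorm n (fun i => q i.castSucc) (fun y => f z.1 (Fin.snoc y z.2)) := by
        apply mixedLnorm_meas n _ (T × ℝ) (fun z y => f z.1 (Fin.snoc y z.2))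
        apply hf.comp (f := fun w : (T × ℝ) × (Fin n → ℝ) =>
          (w.1.1, (Fin.snoc w.2 w.1.2 : Fin (n + 1) → ℝ)))
        exact (measurable_fst.comp measurable_fst).prodMk
          ((measurable_snoc n).comp (measurable_snd.prodMk (measurable_snd.comp measurable_fst)))
      refine le_trans ?_ (lp_minkowski μ (q (Fin.last n)) (hq _) (fun t u =>
        mixedLnorm n (fun i => q i.castSucc) (fun y => f t (Fin.snoc y u))) m1)
      apply ENNReal.rpow_le_rpow _ (by positivity)
      apply lintegral_mono
      intro u
      apply ENNReal.rpow_le_rpow _ h0.le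
      apply ih _ (fun i => hq _) (fun i => hq0 _) T μ (fun t y => f t (Fin.snoc y u))
      apply hf.comp (f := fun w : T × (Fin n → ℝ) =>
          (w.1, (Fin.snoc w.2 u : Fin (n + 1) → ℝ)))
      exact measurable_fst.prodMk
        ((measurable_snoc n).comp (measurable_snd.prodMk measurable_const))
  · induction n with
    | zero => intro f _ _; exact le_rfl
    | succ n ih =>
      intro f hmono hf
      simp only [mixedLnorm_succ]
      have h0 := hq0 (Fin.last n)
      have m0 : ∀ k, Measurable fun z : ℝ × (Fin n → ℝ) => f k (Fin.snoc z.2 z.1) := fun k =>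
        (hf k).comp ((measurable_snoc n).comp measurable_swap)
      have mm : ∀ u : ℝ, Monotone fun k => mixedLnorm n (fun i => q i.castSucc)
          (fun y => f k (Fin.snoc y u)) := fun u a b hab =>
        mixedLnorm_mono _ _ (fun i => hq0 _) _ _ fun y => hmono hab _
      have e1 : ∀ u : ℝ, mixedLnorm n (fun i => q i.castSucc)
          (fun y => ⨆ k, f k (Fin.snoc y u)) ^ q (Fin.last n) ≤
          ⨆ k, mixedLnorm n (fun i => q i.castSucc)
          (fun y => f k (Fin.snoc y u)) ^ q (Fin.last n) := by
        intro u
        have := ih (fun i => q i.castSucc) (fun i => hq _) (fun i => hq0 _)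
          (fun k y => f k (Fin.snoc y u)) (fun a b hab y => hmono hab _)
          (fun k => (m0 k).comp (measurable_const.prodMk measurable_id))
        refine (ENNReal.rpow_le_rpow this h0.le).trans ?_
        rw [← ENNReal.orderIsoRpow_apply _ h0, OrderIso.map_iSup]
        simp
      have e2 : (∫⁻ u : ℝ, mixedLnorm n (fun i => q i.castSucc)
          (fun y => ⨆ k, f k (Fin.snoc y u)) ^ q (Fin.last n)) ≤
          ⨆ k, ∫⁻ u : ℝ, mixedLnorm n (fun i => q i.castSucc)
          (fun y => f k (Fin.snoc y u)) ^ q (Fin.last n) := by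
        refine (lintegral_mono e1).trans ?_
        rw [lintegral_iSup]
        · intro k
          exact (mixedLnorm_meas n _ ℝ (fun u y => f k (Fin.snoc y u)) (m0 k)).pow_const _
        · intro a b hab u
          exact ENNReal.rpow_le_rpow (mm u hab) h0.le
      refine (ENNReal.rpow_le_rpow e2 (by positivity)).trans ?_
      rw [← ENNReal.orderIsoRpow_apply _ (by positivity), OrderIso.map_iSup]
      simp

theorem layer_real (r h : ℝ) (hr : 0 < r) (hh : 0 ≤ h) :
    ∫⁻ l in Ioo (0 : ℝ) h, ENNReal.ofReal (l ^ (r - 1)) = ENNReal.ofReal (h ^ r / r) := by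
  rw [setLIntegral_congr Ioo_ae_eq_Ioc, ← ofReal_integral_eq_lintegral_ofReal]
  · rw [← intervalIntegral.integral_of_le hh, integral_rpow (Or.inl (by linarith))]
    simp [hr.ne']
  · have := intervalIntegral.intervalIntegrable_rpow' (a := 0) (b := h) (r := r - 1) (by linarith)
    rwa [intervalIntegrable_iff_integrableOn_Ioc_of_le hh] at this
  · filter_upwards [ae_restrict_mem measurableSet_Ioc] with l hl
    exact Real.rpow_nonneg hl.1.le _

theorem layer (r : ℝ) (hr : 0 < r) (H : ℝ≥0∞) :
    ∫⁻ l in Ioi (0 : ℝ), (if ENNReal.ofReal l < H then ENNReal.ofReal (l ^ (r - 1)) else 0)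
      = ENNReal.ofReal (1 / r) * H ^ r := by
  have fin : ∀ h : ℝ, 0 ≤ h → ∫⁻ l in Ioi (0 : ℝ),
      (if ENNReal.ofReal l < ENNReal.ofReal h then ENNReal.ofReal (l ^ (r - 1)) else 0)
      = ENNReal.ofReal (1 / r) * (ENNReal.ofReal h) ^ r := by
    intro h hh
    rw [ENNReal.ofReal_rpow_of_nonneg hh hr.le, ← ENNReal.ofReal_mul (by positivity)]
    rw [show 1 / r * h ^ r = h ^ r / r by ring, ← layer_real r h hr hh,
      ← lintegral_indicator measurableSet_Ioo, ← lintegral_indicator measurableSet_Ioi]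
    congr 1
    ext l
    by_cases h0 : 0 < l
    · by_cases h1 : l < h
      · rw [indicator_of_mem (by exact h0), indicator_of_mem (by exact ⟨h0, h1⟩), if_pos]
        exact (ENNReal.ofReal_lt_ofReal_iff (by linarith)).2 h1
      · rw [indicator_of_mem (by exact h0), indicator_of_notMem (by simp [h1]), if_neg]
        push Not at h1 ⊢
        exact ENNReal.ofReal_le_ofReal h1
    · rw [indicator_of_notMem (by simpa using h0), indicator_of_notMem (by simp [h0])]
  rcases eq_or_ne H ⊤ with rfl | hH
  · rw [ENNReal.top_rpow_of_pos hr, ENNReal.mul_top (by simpa using hr)]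
    apply ENNReal.eq_top_of_forall_nnreal_le
    intro c
    have hb : (c : ℝ≥0∞) = ENNReal.ofReal (1 / r) *
        (ENNReal.ofReal ((r * c) ^ (1 / r))) ^ r := by
      rw [ENNReal.ofReal_rpow_of_nonneg (by positivity) hr.le, ← Real.rpow_mul (by positivity),
        ← ENNReal.ofReal_mul (by positivity)]
      rw [one_div_mul_cancel hr.ne', Real.rpow_one, ← mul_assoc, one_div_mul_cancel hr.ne']
      simp
    rw [hb, ← fin _ (by positivity)]
    apply lintegral_mono
    intro l
    simp only [ENNReal.ofReal_lt_top, if_true]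
    split_ifs <;> simp
  · have := fin H.toReal ENNReal.toReal_nonneg
    rwa [ENNReal.ofReal_toReal hH] at this

theorem layer_int (r : ℝ) (hr : 0 < r) (F W : ℝ → ℝ≥0∞) (hF : Measurable F) (hW : Measurable W) :
    ∫⁻ l in Ioi (0 : ℝ), (∫⁻ t in {t | ENNReal.ofReal l < F t}, W t) * ENNReal.ofReal (l ^ (r - 1))
      = ENNReal.ofReal (1 / r) * ∫⁻ t, W t * F t ^ r := by
  have ms : ∀ l : ℝ, MeasurableSet {t | ENNReal.ofReal l < F t} := fun l =>
    measurableSet_lt measurable_const hF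
  have hm2 : Measurable fun l : ℝ => ENNReal.ofReal (l ^ (r - 1)) :=
    ENNReal.measurable_ofReal.comp (measurable_id.pow_const _)
  have hm : Measurable fun z : ℝ × ℝ => W z.2 *
      (if ENNReal.ofReal z.1 < F z.2 then ENNReal.ofReal (z.1 ^ (r - 1)) else 0) := by
    apply (hW.comp measurable_snd).mul
    apply Measurable.ite
    · exact measurableSet_lt (ENNReal.measurable_ofReal.comp measurable_fst)
        (hF.comp measurable_snd)
    · exact hm2.comp measurable_fst
    · exact measurable_const
  calc _ = ∫⁻ l in Ioi (0 : ℝ), ∫⁻ t, W t *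
      (if ENNReal.ofReal l < F t then ENNReal.ofReal (l ^ (r - 1)) else 0) := by
        apply lintegral_congr
        intro l
        rw [← lintegral_indicator (ms l), ← lintegral_mul_const _ (hW.indicator (ms l))]
        apply lintegral_congr
        intro t
        by_cases h : ENNReal.ofReal l < F t <;> simp [indicator, h]
    _ = ∫⁻ t, ∫⁻ l in Ioi (0 : ℝ), W t *
      (if ENNReal.ofReal l < F t then ENNReal.ofReal (l ^ (r - 1)) else 0) := by
        rw [lintegral_lintegral_swap]
        exact hm.aemeasurable
    _ = ∫⁻ t, ENNReal.ofReal (1 / r) * (W t * F t ^ r) := by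
        apply lintegral_congr
        intro t
        rw [lintegral_const_mul, layer r hr]
        · ring
        · apply Measurable.ite _ hm2 measurable_const
          exact measurableSet_lt ENNReal.measurable_ofReal measurable_const
    _ = _ := by
        rw [lintegral_const_mul]
        exact hW.mul (hF.pow_const _)

theorem good_up (p q : ℝ) (hq : 0 < q) (hpq : q < p) (C : ℝ≥0∞) (hC : C ≠ ⊤) :
    ∃ C' : ℝ≥0∞, C' ≠ ⊤ ∧ ∀ F G : ℝ → ℝ≥0∞, Measurable F → Measurable G →
      (∀ l : ℝ, 0 < l → ENNReal.ofReal l ^ q * volume {t | ENNReal.ofReal l < F t / 2}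
        ≤ C * ∫⁻ t in {t | ENNReal.ofReal l < F t}, G t ^ q) →
      ∫⁻ t, F t ^ p ≠ ⊤ → ∫⁻ t, F t ^ p ≤ C' * ∫⁻ t, G t ^ p := by
  have hp : 0 < p := hq.trans hpq
  set D : ℝ≥0∞ := ENNReal.ofReal p * 2 ^ p * C * ENNReal.ofReal (1 / (p - q)) with hD
  have hDt : D ≠ ⊤ := by
    rw [hD]
    have : (2 : ℝ≥0∞) ^ p ≠ ⊤ := ENNReal.rpow_ne_top_of_nonneg hp.le (by simp)
    finiteness
  refine ⟨D ^ (p / q), ENNReal.rpow_ne_top_of_nonneg (by positivity) hDt, ?_⟩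
  intro F G hF hG hFG hfin
  set X := ∫⁻ t, G t ^ p
  set Y := ∫⁻ t, F t ^ p with hY
  have hF2 : Measurable fun t => F t / 2 := hF.div_const _
  have e1 := layer_int p hp (fun t => F t / 2) (fun _ => 1) hF2 measurable_const
  have e2 := layer_int (p - q) (by linarith) F (fun t => G t ^ q) hF (hG.pow_const _)
  have e3 : ENNReal.ofReal (1 / p) * ∫⁻ t, (F t / 2) ^ p ≤
      C * (ENNReal.ofReal (1 / (p - q)) * ∫⁻ t, G t ^ q * F t ^ (p - q)) := by
    simp only [one_mul] at e1
    rw [← e1, ← e2, ← lintegral_const_mul' _ _ hC]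
    apply setLIntegral_mono' measurableSet_Ioi
    intro l hl
    have hl : 0 < l := hl
    rw [setLIntegral_one]
    have : l ^ (p - 1) = l ^ q * l ^ (p - q - 1) := by
      rw [← Real.rpow_add hl]; ring_nf
    rw [this, ENNReal.ofReal_mul (by positivity), ← ENNReal.ofReal_rpow_of_pos hl,
      mul_comm, mul_right_comm, ← mul_assoc]
    exact mul_le_mul_left (hFG l hl) _
  have e4 : ∫⁻ t, (F t / 2) ^ p = (2 ^ p)⁻¹ * Y := by
    rw [hY, ← lintegral_const_mul _ (hF.pow_const _)]
    apply lintegral_congr; intro t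
    rw [ENNReal.div_rpow_of_nonneg _ _ hp.le, ENNReal.div_eq_inv_mul]
  have e5 : ∫⁻ t, G t ^ q * F t ^ (p - q) ≤ X ^ (q / p) * Y ^ (1 - q / p) := by
    have hc : (p / q).HolderConjugate (p / (p - q)) := by
      have : 0 < p - q := by linarith
      constructor
      · field_simp; ring
      · positivity
      · positivity
    have := ENNReal.lintegral_mul_le_Lp_mul_Lq volume hc (hG.pow_const q).aemeasurable
      (hF.pow_const (p - q)).aemeasurable
    refine this.trans (le_of_eq ?_)
    have hne : p - q ≠ 0 := by linarith
    simp only [← ENNReal.rpow_mul]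
    rw [mul_div_cancel₀ _ hq.ne', mul_div_cancel₀ _ hne, one_div_div, one_div_div, sub_div,
      div_self hp.ne']
  rw [e4] at e3
  have e6 : Y ≤ D * (X ^ (q / p) * Y ^ (1 - q / p)) := by
    have h2 : (2 : ℝ≥0∞) ^ p ≠ ⊤ := ENNReal.rpow_ne_top_of_nonneg hp.le (by simp)
    have h20 : (2 : ℝ≥0∞) ^ p ≠ 0 := by simp
    calc Y = (ENNReal.ofReal p * ENNReal.ofReal (1 / p)) * (2 ^ p * (2 ^ p)⁻¹) * Y := by
          rw [ENNReal.mul_inv_cancel h20 h2, ← ENNReal.ofReal_mul hp.le,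
            mul_one_div_cancel hp.ne']
          simp
      _ = ENNReal.ofReal p * 2 ^ p * (ENNReal.ofReal (1 / p) * ((2 ^ p)⁻¹ * Y)) := by ring
      _ ≤ ENNReal.ofReal p * 2 ^ p * (C * (ENNReal.ofReal (1 / (p - q)) *
          (X ^ (q / p) * Y ^ (1 - q / p)))) := 
          mul_le_mul_right (e3.trans (by gcongr)) _
      _ = _ := by rw [hD]; ring
  by_cases hY0 : Y = 0
  · rw [hY0]; exact zero_le
  have hqp : q / p < 1 := by rw [div_lt_one hp]; exact hpq
  have e7 : Y ^ (q / p) ≤ D * X ^ (q / p) := by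
    have h4 : Y ^ (1 - q / p) ≠ 0 := by
      simp [hY0, hfin]
    have h5 : Y ^ (1 - q / p) ≠ ⊤ := ENNReal.rpow_ne_top_of_nonneg (by linarith) hfin
    apply (ENNReal.mul_le_mul_iff_left h4 h5).1
    rw [← ENNReal.rpow_add _ _ hY0 hfin, mul_assoc]
    simpa using e6
  have e8 := ENNReal.rpow_le_rpow e7 (show 0 ≤ p / q by positivity)
  rw [ENNReal.mul_rpow_of_nonneg _ _ (by positivity), ← ENNReal.rpow_mul, ← ENNReal.rpow_mul] at e8
  have : q / p * (p / q) = 1 := by field_simp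
  simpa [this] using e8

theorem tail (a : ℝ) (ha : 0 < a) (h : ℝ) (hh : 0 < h) :
    ∫⁻ l in Ioi h, ENNReal.ofReal (l ^ (-a - 1)) = ENNReal.ofReal (h ^ (-a) / a) := by
  rw [← ofReal_integral_eq_lintegral_ofReal]
  · rw [integral_Ioi_rpow_of_lt (by linarith) hh]
    congr 1
    simp [neg_div_neg_eq]
  · exact integrableOn_Ioi_rpow_of_lt (by linarith) hh
  · filter_upwards [ae_restrict_mem measurableSet_Ioi] with l hl
    exact Real.rpow_nonneg (hh.trans hl).le _

theorem tail_min (p q : ℝ) (hp : 0 < p) (hpq : p < q) (H : ℝ≥0∞) :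
    ∫⁻ l in Ioi (0 : ℝ), ENNReal.ofReal (l ^ (p - 1 - q)) * (min (2 * ENNReal.ofReal l) H) ^ q
      ≤ (2 ^ q * ENNReal.ofReal (1 / p) + ENNReal.ofReal (1 / (q - p))) * H ^ p := by
  have hq : 0 < q := hp.trans hpq
  rcases eq_or_ne H ⊤ with rfl | hH
  · rw [ENNReal.top_rpow_of_pos hp, ENNReal.mul_top]
    · exact le_top
    · have : ENNReal.ofReal (1 / (q - p)) ≠ 0 := by simpa using hpq
      simp [hpq]
  rcases eq_or_ne H 0 with rfl | hH0
  · simp [hq, hp]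
  set h := H.toReal with hh
  have hpos : 0 < h := ENNReal.toReal_pos hH0 hH
  have hHh : H = ENNReal.ofReal h := (ENNReal.ofReal_toReal hH).symm
  have hm2 : ∀ r : ℝ, Measurable fun l : ℝ => ENNReal.ofReal (l ^ r) := fun r =>
    ENNReal.measurable_ofReal.comp (measurable_id.pow_const _)
  have bound : ∀ l ∈ Ioi (0 : ℝ),
      ENNReal.ofReal (l ^ (p - 1 - q)) * (min (2 * ENNReal.ofReal l) H) ^ q ≤
      2 ^ q * (if ENNReal.ofReal l < H then ENNReal.ofReal (l ^ (p - 1)) else 0) +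
      H ^ q * (Ici h).indicator (fun l => ENNReal.ofReal (l ^ (-(q - p) - 1))) l := by
    intro l hl
    have hl : 0 < l := hl
    by_cases hlh : l < h
    · have : ENNReal.ofReal l < H := by
        rw [hHh]; exact (ENNReal.ofReal_lt_ofReal_iff hpos).2 hlh
      rw [if_pos this]
      refine le_trans ?_ le_self_add
      calc _ ≤ ENNReal.ofReal (l ^ (p - 1 - q)) * (2 * ENNReal.ofReal l) ^ q := by
            gcongr; exact min_le_left _ _
        _ = _ := by
            rw [ENNReal.mul_rpow_of_nonneg _ _ hq.le, mul_left_comm,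
              ENNReal.ofReal_rpow_of_pos hl, ← ENNReal.ofReal_mul (by positivity),
              ← Real.rpow_add hl]
            ring_nf
    · refine le_trans ?_ le_add_self
      rw [indicator_of_mem (by simpa using hlh), mul_comm]
      rw [show -(q - p) - 1 = p - 1 - q by ring]
      gcongr; exact min_le_right _ _
  refine (setLIntegral_mono' measurableSet_Ioi bound).trans ?_
  rw [lintegral_add_right, lintegral_const_mul, lintegral_const_mul, layer p hp, add_mul]
  · rw [mul_assoc]
    refine add_le_add_right ?_ _
    rw [setLIntegral_indicator measurableSet_Ici]
    have : Ici h ∩ Ioi 0 = Ici h := inter_eq_left.2 fun x hx => hpos.trans_le hx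
    rw [this, setLIntegral_congr Ioi_ae_eq_Ici.symm, tail (q - p) (by linarith) h hpos, hHh,
      ENNReal.ofReal_rpow_of_pos hpos, ENNReal.ofReal_rpow_of_pos hpos,
      ← ENNReal.ofReal_mul (by positivity)]
    have hqp : 0 < q - p := by linarith
    rw [← ENNReal.ofReal_mul (by positivity)]
    apply ENNReal.ofReal_le_ofReal
    apply le_of_eq
    rw [mul_div_assoc', ← Real.rpow_add hpos]
    ring_nf
  · exact (hm2 _).indicator measurableSet_Ici
  · apply Measurable.ite _ (hm2 _) measurable_const
    exact measurableSet_lt ENNReal.measurable_ofReal measurable_const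
  · exact ((hm2 _).indicator measurableSet_Ici).const_mul _

theorem good_down (p q : ℝ) (hp : 0 < p) (hpq : p < q) (C : ℝ≥0∞) (hC : C ≠ ⊤) :
    ∃ C' : ℝ≥0∞, C' ≠ ⊤ ∧ ∀ F H : ℝ → ℝ≥0∞, Measurable F → Measurable H →
      (∀ l : ℝ, 0 < l → volume {t | ENNReal.ofReal l < F t}
        ≤ volume {t | ENNReal.ofReal l < H t}
          + C * (ENNReal.ofReal (l ^ (-q)) * ∫⁻ t, min (2 * ENNReal.ofReal l) (H t) ^ q)) →
      ∫⁻ t, F t ^ p ≤ C' * ∫⁻ t, H t ^ p := by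
  have hq : 0 < q := hp.trans hpq
  set E : ℝ≥0∞ := 2 ^ q * ENNReal.ofReal (1 / p) + ENNReal.ofReal (1 / (q - p)) with hE
  have hEt : E ≠ ⊤ := by
    have : (2 : ℝ≥0∞) ^ q ≠ ⊤ := ENNReal.rpow_ne_top_of_nonneg hq.le (by simp)
    rw [hE]; finiteness
  refine ⟨1 + ENNReal.ofReal p * (C * E), by finiteness, ?_⟩
  intro F H hF hH hyp
  have e1 := layer_int p hp F (fun _ => 1) hF measurable_const
  have e2 := layer_int p hp H (fun _ => 1) hH measurable_const
  simp only [one_mul, setLIntegral_one] at e1 e2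
  have hm2 : ∀ r : ℝ, Measurable fun l : ℝ => ENNReal.ofReal (l ^ r) := fun r =>
    ENNReal.measurable_ofReal.comp (measurable_id.pow_const _)
  have hmm : Measurable fun z : ℝ × ℝ => ENNReal.ofReal (z.1 ^ (p - 1 - q)) *
      min (2 * ENNReal.ofReal z.1) (H z.2) ^ q := by
    apply ((hm2 _).comp measurable_fst).mul
    apply Measurable.pow_const
    exact ((ENNReal.measurable_ofReal.comp measurable_fst).const_mul _).min
      (hH.comp measurable_snd)
  have e3 : ENNReal.ofReal (1 / p) * ∫⁻ t, F t ^ p ≤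
      ENNReal.ofReal (1 / p) * (∫⁻ t, H t ^ p) + C * (E * ∫⁻ t, H t ^ p) := by
    calc _ = _ := e1.symm
      _ ≤ ∫⁻ l in Ioi (0 : ℝ), (volume {t | ENNReal.ofReal l < H t} * ENNReal.ofReal (l ^ (p - 1)) +
          C * ∫⁻ t, ENNReal.ofReal (l ^ (p - 1 - q)) *
            min (2 * ENNReal.ofReal l) (H t) ^ q) := by
          apply setLIntegral_mono' measurableSet_Ioi
          intro l hl
          have hl : 0 < l := hl
          refine (mul_le_mul_left (hyp l hl) _).trans (le_of_eq ?_)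
          rw [add_mul]
          congr 1
          rw [lintegral_const_mul' _ _ (by simp), mul_assoc, mul_right_comm,
            ← ENNReal.ofReal_mul (by positivity), ← Real.rpow_add hl]
          ring_nf
      _ = ENNReal.ofReal (1 / p) * (∫⁻ t, H t ^ p) + C * ∫⁻ t, ∫⁻ l in Ioi (0 : ℝ),
            ENNReal.ofReal (l ^ (p - 1 - q)) * min (2 * ENNReal.ofReal l) (H t) ^ q := by
          rw [lintegral_add_right, e2, lintegral_const_mul' _ _ hC, lintegral_lintegral_swap]
          · exact hmm.aemeasurable
          · exact (hmm.lintegral_prod_right').const_mul _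
      _ ≤ _ := by
          gcongr
          rw [← lintegral_const_mul' _ _ hEt]
          apply lintegral_mono
          intro t
          exact tail_min p q hp hpq (H t)
  have h1 : ENNReal.ofReal p * ENNReal.ofReal (1 / p) = 1 := by
    rw [← ENNReal.ofReal_mul hp.le, mul_one_div_cancel hp.ne']; simp
  calc ∫⁻ t, F t ^ p = ENNReal.ofReal p * (ENNReal.ofReal (1 / p) * ∫⁻ t, F t ^ p) := by
        rw [← mul_assoc, h1, one_mul]
    _ ≤ ENNReal.ofReal p * _ := mul_le_mul_right e3 _
    _ = (ENNReal.ofReal p * ENNReal.ofReal (1 / p) + ENNReal.ofReal p * (C * E)) * ∫⁻ t, H t ^ p := by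
        ring
    _ = _ := by rw [h1]

/-- A nested sequence of doubling partitions of the line. -/
structure Grid where
  idx : ℕ → ℝ → ℤ
  w : ℕ → ℝ≥0∞
  meas : ∀ k, Measurable (idx k)
  nest : ∀ k s t, idx (k + 1) s = idx (k + 1) t → idx k s = idx k t
  vol : ∀ k t, volume {s | idx k s = idx k t} = w k
  wpos : ∀ k, w k ≠ 0
  wfin : ∀ k, w k ≠ ⊤
  dbl : ∀ k, w k ≤ 2 * w (k + 1)

namespace Grid

variable (D : Grid)

def cell (k : ℕ) (t : ℝ) : Set ℝ := {s | D.idx k s = D.idx k t}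

def avg (k : ℕ) (g : ℝ → ℝ≥0∞) (t : ℝ) : ℝ≥0∞ := (D.w k)⁻¹ * ∫⁻ s in D.cell k t, g s

def mx (K : ℕ) (g : ℝ → ℝ≥0∞) (t : ℝ) : ℝ≥0∞ := ⨆ (k : ℕ) (_ : k ≤ K), D.avg k g t

/-- `h` is constant on cells of level `k`. -/
def Lev {β : Type} (k : ℕ) (h : ℝ → β) : Prop := ∀ s t, D.idx k s = D.idx k t → h s = h t

theorem nest_le {j k : ℕ} (h : j ≤ k) {s t : ℝ} (e : D.idx k s = D.idx k t) :
    D.idx j s = D.idx j t := by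
  induction h with
  | refl => exact e
  | step _ ih => exact ih (D.nest _ _ _ e)

theorem Lev.up {D : Grid} {β : Type} {j k : ℕ} (h : j ≤ k) {f : ℝ → β} (hf : D.Lev j f) :
    D.Lev k f := fun s t e => hf s t (D.nest_le h e)

theorem meas_cell (k : ℕ) (t : ℝ) : MeasurableSet (D.cell k t) :=
  D.meas k (measurableSet_singleton (D.idx k t))

theorem vol_cell (k : ℕ) (t : ℝ) : volume (D.cell k t) = D.w k := D.vol k t

theorem cell_eq {k : ℕ} {s t : ℝ} (e : D.idx k s = D.idx k t) : D.cell k s = D.cell k t := by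
  simp [cell, e]

theorem cell_sub {j k : ℕ} (h : j ≤ k) (t : ℝ) : D.cell k t ⊆ D.cell j t :=
  fun _ hs => D.nest_le h hs

theorem mem_cell (k : ℕ) (t : ℝ) : t ∈ D.cell k t := rfl

theorem lev_avg (k : ℕ) (g : ℝ → ℝ≥0∞) : D.Lev k (D.avg k g) := by
  intro s t e
  simp [avg, D.cell_eq e]

theorem lev_mx (k : ℕ) (g : ℝ → ℝ≥0∞) : D.Lev k (D.mx k g) := by
  intro s t e
  simp only [mx]
  congr 1; ext j; congr 1; ext hj
  exact (D.lev_avg j g).up hj s t e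

theorem avg_le_mx {k K : ℕ} (h : k ≤ K) (g : ℝ → ℝ≥0∞) (t : ℝ) : D.avg k g t ≤ D.mx K g t :=
  le_iSup₂_of_le k h le_rfl

theorem mx_le_mx {k K : ℕ} (h : k ≤ K) (g : ℝ → ℝ≥0∞) (t : ℝ) : D.mx k g t ≤ D.mx K g t :=
  iSup₂_le fun _ hj => D.avg_le_mx (hj.trans h) g t

theorem avg_mono (k : ℕ) {f g : ℝ → ℝ≥0∞} (h : f ≤ g) (t : ℝ) : D.avg k f t ≤ D.avg k g t := by
  unfold avg
  gcongr
  exact h _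

theorem avg_eq (k : ℕ) (g : ℝ → ℝ≥0∞) (t : ℝ) :
    D.avg k g t = ∫⁻ s, g s ∂((D.w k)⁻¹ • volume.restrict (D.cell k t)) := by
  rw [lintegral_smul_measure]; rfl

theorem avg_measurable {T : Type} [MeasurableSpace T] (k : ℕ) (f : ℝ → T → ℝ≥0∞)
    (hf : Measurable (Function.uncurry f)) :
    Measurable fun z : ℝ × T => D.avg k (fun s => f s z.2) z.1 := by
  unfold avg
  apply Measurable.const_mul
  have : ∀ z : ℝ × T, ∫⁻ s in D.cell k z.1, f s z.2 =
      ∫⁻ s, (if D.idx k s = D.idx k z.1 then f s z.2 else 0) := by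
    intro z
    rw [← lintegral_indicator (D.meas_cell k z.1)]
    apply lintegral_congr; intro s
    by_cases h : D.idx k s = D.idx k z.1 <;> simp [indicator, cell, h]
  simp only [this]
  apply Measurable.lintegral_prod_right' (f := fun w : (ℝ × T) × ℝ =>
    if D.idx k w.2 = D.idx k w.1.1 then f w.2 w.1.2 else 0)
  apply Measurable.ite
  · exact measurableSet_eq_fun ((D.meas k).comp measurable_snd)
      ((D.meas k).comp (measurable_fst.comp measurable_fst))
  · exact hf.comp (measurable_snd.prodMk (measurable_snd.comp measurable_fst))
  · exact measurable_const

theorem mx_measurable {T : Type} [MeasurableSpace T] (K : ℕ) (f : ℝ → T → ℝ≥0∞)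
    (hf : Measurable (Function.uncurry f)) :
    Measurable fun z : ℝ × T => D.mx K (fun s => f s z.2) z.1 := by
  unfold mx
  apply Measurable.iSup; intro k
  apply Measurable.iSup; intro _
  exact D.avg_measurable k f hf

theorem avg_measurable' (k : ℕ) (g : ℝ → ℝ≥0∞) (hg : Measurable g) : Measurable (D.avg k g) :=
  (D.avg_measurable (T := Unit) k (fun s _ => g s) (hg.comp measurable_fst)).comp
    (f := fun t => (t, ())) (measurable_id.prodMk (measurable_const (a := ())))

theorem mx_measurable' (k : ℕ) (g : ℝ → ℝ≥0∞) (hg : Measurable g) : Measurable (D.mx k g) :=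
  (D.mx_measurable (T := Unit) k (fun s _ => g s) (hg.comp measurable_fst)).comp
    (f := fun t => (t, ())) (measurable_id.prodMk (measurable_const (a := ())))

theorem fiber_sum (k : ℕ) (F : ℝ → ℝ≥0∞) :
    ∫⁻ s, F s = ∑' j : ℤ, ∫⁻ s in (D.idx k) ⁻¹' {j}, F s := by
  rw [← lintegral_iUnion]
  · have : ⋃ i, D.idx k ⁻¹' {i} = univ := by ext; simp
    rw [this, setLIntegral_univ]
  · intro j; exact D.meas k (measurableSet_singleton j)
  · intro i j hij
    exact Disjoint.preimage _ (by simpa using hij)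

theorem tower (k : ℕ) (h g : ℝ → ℝ≥0∞) (hh : D.Lev k h) (hg : Measurable g) :
    ∫⁻ s, h s * D.avg k g s = ∫⁻ s, h s * g s := by
  rw [D.fiber_sum k, D.fiber_sum k]
  congr 1; ext j
  by_cases hne : ∃ t, D.idx k t = j
  · obtain ⟨t, rfl⟩ := hne
    change ∫⁻ s in D.cell k t, _ = ∫⁻ s in D.cell k t, _
    have e1 : ∫⁻ s in D.cell k t, h s * D.avg k g s = ∫⁻ s in D.cell k t, h t * D.avg k g t :=
      setLIntegral_congr_fun (D.meas_cell k t) fun s hs => by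
        simp only [hh s t hs, D.lev_avg k g s t hs]
    have e2 : ∫⁻ s in D.cell k t, h s * g s = ∫⁻ s in D.cell k t, h t * g s :=
      setLIntegral_congr_fun (D.meas_cell k t) fun s hs => by
        simp only [hh s t hs]
    rw [e1, e2, lintegral_const_mul _ hg, setLIntegral_const, D.vol_cell, avg, mul_assoc]
    congr 1
    rw [mul_right_comm, ENNReal.inv_mul_cancel (D.wpos k) (D.wfin k), one_mul]
  · have : D.idx k ⁻¹' {j} = ∅ := by
      ext s; simp only [mem_preimage, mem_singleton_iff, mem_empty_iff_false, iff_false]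
      exact fun hs => hne ⟨s, hs⟩
    simp [this]

theorem mx_succ (K : ℕ) (g : ℝ → ℝ≥0∞) (t : ℝ) :
    D.mx (K + 1) g t ≤ D.mx K g t + D.avg (K + 1) g t := by
  refine iSup₂_le fun k hk => ?_
  rcases Nat.le_succ_iff.1 hk with h | h
  · exact (D.avg_le_mx h g t).trans le_self_add
  · subst h; exact le_add_self

theorem avg_dbl (k : ℕ) (g : ℝ → ℝ≥0∞) (t : ℝ) : D.avg (k + 1) g t ≤ 2 * D.avg k g t := by
  unfold avg
  rw [← mul_assoc]
  apply mul_le_mul'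
  · rw [ENNReal.inv_le_iff_inv_le, ENNReal.mul_inv (Or.inl (by simp)) (Or.inl (by simp)), inv_inv]
    rw [mul_comm, ← div_eq_mul_inv, ENNReal.div_le_iff (by simp) (by simp), mul_comm]
    exact D.dbl k
  · exact lintegral_mono_set (D.cell_sub (Nat.le_succ k) t)

theorem avg_rpow_le (p : ℝ) (hp : 1 < p) (k : ℕ) (g : ℝ → ℝ≥0∞) (hg : Measurable g) (t : ℝ) :
    D.avg k g t ^ p ≤ D.avg k (fun s => g s ^ p) t := by
  rw [avg_eq, avg_eq]
  set μ := (D.w k)⁻¹ • volume.restrict (D.cell k t) with hμ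
  have hu : μ univ = 1 := by
    simp [hμ, D.vol_cell, ENNReal.inv_mul_cancel (D.wpos k) (D.wfin k)]
  have hc : p.HolderConjugate p.conjExponent := Real.HolderConjugate.conjExponent hp
  have := ENNReal.lintegral_mul_le_Lp_mul_Lq μ hc hg.aemeasurable
    (aemeasurable_const (b := (1 : ℝ≥0∞)))
  simp only [Pi.mul_apply, mul_one, ENNReal.one_rpow, lintegral_const, hu] at this
  have h2 := ENNReal.rpow_le_rpow this (show 0 ≤ p by linarith)
  rwa [← ENNReal.rpow_mul, one_div_mul_cancel (by linarith), ENNReal.rpow_one] at h2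

theorem lintegral_avg (k : ℕ) (g : ℝ → ℝ≥0∞) (hg : Measurable g) :
    ∫⁻ s, D.avg k g s = ∫⁻ s, g s := by
  have := D.tower k (fun _ => 1) g (fun _ _ _ => rfl) hg
  simpa using this

theorem mx_fin (p : ℝ) (hp : 1 < p) (K : ℕ) (g : ℝ → ℝ≥0∞) (hg : Measurable g)
    (hfin : ∫⁻ t, g t ^ p ≠ ⊤) : ∫⁻ t, D.mx K g t ^ p ≠ ⊤ := by
  have hp0 : 0 < p := by linarith
  apply ne_of_lt
  calc ∫⁻ t, D.mx K g t ^ p ≤ ∫⁻ t, ∑ k ∈ Finset.range (K + 1), D.avg k (fun s => g s ^ p) t := by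
        apply lintegral_mono; intro t
        rw [← ENNReal.le_rpow_inv_iff hp0]
        refine iSup₂_le fun k hk => ?_
        rw [ENNReal.le_rpow_inv_iff hp0]
        refine (D.avg_rpow_le p hp k g hg t).trans ?_
        exact Finset.single_le_sum (f := fun k => D.avg k (fun s => g s ^ p) t)
          (fun _ _ => zero_le) (Finset.mem_range.2 (Nat.lt_succ_of_le hk))
    _ = ∑ k ∈ Finset.range (K + 1), ∫⁻ t, g t ^ p := by
        rw [lintegral_finsetSum _ fun k _ => D.avg_measurable' k _ (hg.pow_const _)]
        congr 1; ext k
        exact D.lintegral_avg k _ (hg.pow_const _)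
    _ < ⊤ := by
        rw [ENNReal.sum_lt_top]
        intro k _; exact hfin.lt_top

/-- The stopping sets. -/
def stp (G : ℝ → ℝ≥0∞) (l : ℝ≥0∞) (k : ℕ) : Set ℝ :=
  {t | l < D.avg k G t ∧ ∀ j < k, D.avg j G t ≤ l}

theorem stp_lev (G : ℝ → ℝ≥0∞) (l : ℝ≥0∞) (k : ℕ) {s t : ℝ} (e : D.idx k s = D.idx k t)
    (hs : s ∈ D.stp G l k) : t ∈ D.stp G l k := by
  refine ⟨?_, fun j hj => ?_⟩
  · rw [← D.lev_avg k G s t e]; exact hs.1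
  · rw [← (D.lev_avg j G).up hj.le s t e]; exact hs.2 j hj

theorem stp_unique (G : ℝ → ℝ≥0∞) (l : ℝ≥0∞) {j k : ℕ} {t : ℝ} (hj : t ∈ D.stp G l j)
    (hk : t ∈ D.stp G l k) : j = k := by
  rcases lt_trichotomy j k with h | h | h
  · exact absurd hj.1 (not_lt.2 (hk.2 j h))
  · exact h
  · exact absurd hk.1 (not_lt.2 (hj.2 k h))

theorem stp_iff (G : ℝ → ℝ≥0∞) (l : ℝ≥0∞) (K : ℕ) (t : ℝ) :
    l < D.mx K G t ↔ ∃ k ≤ K, t ∈ D.stp G l k := by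
  constructor
  · intro h
    have hex : ∃ k, k ≤ K ∧ l < D.avg k G t := by
      simpa [mx, lt_iSup_iff] using h
    classical
    refine ⟨Nat.find hex, (Nat.find_spec hex).1, (Nat.find_spec hex).2, fun j hj => ?_⟩
    have := Nat.find_min hex hj
    by_contra hc
    exact this ⟨hj.le.trans (Nat.find_spec hex).1, not_le.1 hc⟩
  · rintro ⟨k, hk, h⟩
    exact h.1.trans_le (D.avg_le_mx hk G t)

theorem stp_meas (G : ℝ → ℝ≥0∞) (hG : Measurable G) (l : ℝ≥0∞) (k : ℕ) :
    MeasurableSet (D.stp G l k) := by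
  have : D.stp G l k = {t | l < D.avg k G t} ∩ ⋂ j, ⋂ (_ : j < k), {t | D.avg j G t ≤ l} := by
    ext t; simp [stp]
  rw [this]
  apply (measurableSet_lt measurable_const (D.avg_measurable' k G hG)).inter
  refine MeasurableSet.iInter fun j => MeasurableSet.iInter fun _ => ?_
  exact measurableSet_le (D.avg_measurable' j G hG) measurable_const

theorem weak (G : ℝ → ℝ≥0∞) (hG : Measurable G) (l : ℝ≥0∞) (K : ℕ) :
    l * volume {t | l < D.mx K G t} ≤ ∫⁻ t in {t | l < D.mx K G t}, G t := by
  have hU : {t | l < D.mx K G t} = ⋃ k ∈ Finset.range (K + 1), D.stp G l k := by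
    ext t
    simp only [mem_ofPred_eq, D.stp_iff, mem_iUnion, Finset.mem_range, Nat.lt_succ_iff, exists_prop]
  have hd : Set.PairwiseDisjoint (↑(Finset.range (K + 1))) (D.stp G l) := by
    intro i _ j _ hij
    rw [Function.onFun, Set.disjoint_left]
    intro t hi hj
    exact hij (D.stp_unique G l hi hj)
  rw [hU, lintegral_biUnion_finset hd fun k _ => D.stp_meas G hG l k,
    measure_biUnion_finset hd fun k _ => D.stp_meas G hG l k, Finset.mul_sum]
  apply Finset.sum_le_sum
  intro k _
  calc l * volume (D.stp G l k) = ∫⁻ t in D.stp G l k, l := by rw [setLIntegral_const]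
    _ ≤ ∫⁻ t in D.stp G l k, D.avg k G t :=
        setLIntegral_mono' (D.stp_meas G hG l k) fun t ht => ht.1.le
    _ = ∫⁻ t in D.stp G l k, G t := by
        have := D.tower k ((D.stp G l k).indicator 1) G (fun s t e => by
          by_cases hs : s ∈ D.stp G l k
          · rw [indicator_of_mem hs, indicator_of_mem (D.stp_lev G l k e hs)]; rfl
          · rw [indicator_of_notMem hs, indicator_of_notMem]
            exact fun ht => hs (D.stp_lev G l k e.symm ht)) hG
        rw [← lintegral_indicator (D.stp_meas G hG l k), ← lintegral_indicator (D.stp_meas G hG l k)]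
        have e : ∀ g : ℝ → ℝ≥0∞, ∫⁻ s, (D.stp G l k).indicator g s =
            ∫⁻ s, (D.stp G l k).indicator 1 s * g s := by
          intro g
          apply lintegral_congr; intro s
          by_cases hs : s ∈ D.stp G l k <;> simp [hs]
        rw [e, e]
        exact this

end Grid

theorem doob (p : ℝ) (hp : 1 < p) : ∃ C : ℝ≥0∞, C ≠ ⊤ ∧ ∀ (D : Grid) (K : ℕ) (g : ℝ → ℝ≥0∞),
    Measurable g → ∫⁻ t, D.mx K g t ^ p ≤ C * ∫⁻ t, g t ^ p := by
  obtain ⟨C, hC, h⟩ := good_up p 1 one_pos hp 1 (by simp)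
  refine ⟨C + 1, by finiteness, ?_⟩
  intro D K g hg
  by_cases hfin : ∫⁻ t, g t ^ p = ⊤
  · rw [hfin, ENNReal.mul_top (by simp)]; exact le_top
  refine (h (D.mx K g) g (D.mx_measurable' K g hg) hg ?_ (D.mx_fin p hp K g hg hfin)).trans ?_
  · intro l hl
    simp only [ENNReal.rpow_one, one_mul]
    refine le_trans ?_ (D.weak g hg (ENNReal.ofReal l) K)
    gcongr
    exact ENNReal.div_le_of_le_mul (le_mul_of_one_le_right zero_le (by norm_num))
  · gcongr; exact le_self_add

def Bdd {Y : Type} [MeasurableSpace Y] (N : (Y → ℝ≥0∞) → ℝ≥0∞) (p : ℝ) : Prop :=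
  ∃ C : ℝ≥0∞, C ≠ ⊤ ∧ ∀ (D : Grid) (K : ℕ) (f : ℝ → Y → ℝ≥0∞),
    Measurable (Function.uncurry f) →
    ∫⁻ t, N (fun y => D.mx K (fun s => f s y) t) ^ p ≤ C * ∫⁻ t, N (f t) ^ p

section
variable {Y : Type} [MeasurableSpace Y] {N : (Y → ℝ≥0∞) → ℝ≥0∞}

theorem GoodNorm.zero (hN : GoodNorm N) : N (fun _ => 0) = 0 := by
  have := hN.smul 0 (fun _ => 0) measurable_const
  simpa using this

theorem GoodNorm.avg (hN : GoodNorm N) (D : Grid) (k : ℕ) (f : ℝ → Y → ℝ≥0∞)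
    (hf : Measurable (Function.uncurry f)) (t : ℝ) :
    N (fun y => D.avg k (fun s => f s y) t) ≤ D.avg k (fun s => N (f s)) t := by
  simp_rw [Grid.avg_eq]
  exact hN.mink ℝ _ f hf

theorem meas_section (f : ℝ → Y → ℝ≥0∞) (hf : Measurable (Function.uncurry f)) (y : Y) :
    Measurable fun s => f s y := hf.comp (measurable_id.prodMk (measurable_const (a := y)))

theorem meas_section' (f : ℝ → Y → ℝ≥0∞) (hf : Measurable (Function.uncurry f)) (s : ℝ) :
    Measurable fun y => f s y := hf.comp ((measurable_const (a := s)).prodMk measurable_id)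

theorem GoodNorm.apriori (hN : GoodNorm N) (D : Grid) (K : ℕ) (f : ℝ → Y → ℝ≥0∞)
    (hf : Measurable (Function.uncurry f)) (t : ℝ) :
    N (fun y => D.mx K (fun s => f s y) t) ≤ (K + 1 : ℕ) * D.mx K (fun s => N (f s)) t := by
  induction K with
  | zero =>
    have : ∀ g t, D.mx 0 g t = D.avg 0 g t := by
      intro g t; simp [Grid.mx]
    simp only [this]
    simpa using hN.avg D 0 f hf t
  | succ K ih =>
    calc N (fun y => D.mx (K + 1) (fun s => f s y) t)
        ≤ N (fun y => D.mx K (fun s => f s y) t + D.avg (K + 1) (fun s => f s y) t) :=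
          hN.mono _ _ fun y => D.mx_succ K _ t
      _ ≤ N (fun y => D.mx K (fun s => f s y) t) + N (fun y => D.avg (K + 1) (fun s => f s y) t) :=
          hN.add _ _ (meas_section' (fun t y => D.mx K (fun s => f s y) t) (D.mx_measurable K f hf) t)
            (meas_section' (fun t y => D.avg (K + 1) (fun s => f s y) t)
              (D.avg_measurable (K + 1) f hf) t)
      _ ≤ (K + 1 : ℕ) * D.mx (K + 1) (fun s => N (f s)) t + D.mx (K + 1) (fun s => N (f s)) t := by
          refine add_le_add (ih.trans ?_) ((hN.avg D (K + 1) f hf t).trans (D.avg_le_mx le_rfl _ t))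
          gcongr
          exact D.mx_le_mx (Nat.le_succ K) _ t
      _ = _ := by push_cast; ring

def rst (Ω : Set ℝ) (f : ℝ → Y → ℝ≥0∞) : ℝ → Y → ℝ≥0∞ := fun s y => Ω.indicator (fun s => f s y) s

theorem ind_meas (Ω : Set ℝ) (hΩ : MeasurableSet Ω) (f : ℝ → Y → ℝ≥0∞)
    (hf : Measurable (Function.uncurry f)) :
    Measurable (Function.uncurry (rst Ω f)) := by
  have : Function.uncurry (rst Ω f) =
      (Prod.fst ⁻¹' Ω).indicator (Function.uncurry f) := by
    ext ⟨s, y⟩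
    by_cases h : s ∈ Ω <;> simp [Function.uncurry, rst, h]
  rw [this]
  exact hf.indicator (measurable_fst hΩ)

theorem up_point (hN : GoodNorm N) (D : Grid) (K : ℕ) (f : ℝ → Y → ℝ≥0∞)
    (hf : Measurable (Function.uncurry f)) (l : ℝ≥0∞) (Ω : Set ℝ)
    (hΩ : Ω = {t | l < N (fun y => D.mx K (fun s => f s y) t)}) (t : ℝ) (ht : t ∈ Ω) :
    N (fun y => D.mx K (fun s => f s y) t) ≤
      l + N (fun y => D.mx K (fun s => rst Ω f s y) t) := by
  have hmΩ : MeasurableSet Ω := by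
    rw [hΩ]
    exact measurableSet_lt measurable_const
      (hN.meas ℝ (fun t y => D.mx K (fun s => f s y) t) (D.mx_measurable K f hf))
  have ht' : l < N (fun y => D.mx K (fun s => f s y) t) := by rw [hΩ] at ht; exact ht
  have hex : ∃ k, l < N (fun y => D.mx k (fun s => f s y) t) := ⟨K, ht'⟩
  classical
  obtain ⟨k, hk, hkK, hmin⟩ : ∃ k, l < N (fun y => D.mx k (fun s => f s y) t) ∧ k ≤ K ∧
      ∀ j < k, N (fun y => D.mx j (fun s => f s y) t) ≤ l :=
    ⟨Nat.find hex, Nat.find_spec hex, Nat.find_min' hex ht', fun j hj =>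
      not_lt.1 (Nat.find_min hex hj)⟩
  have hcell : ∀ j, k ≤ j → ∀ y, D.avg j (fun s => f s y) t =
      D.avg j (fun s => rst Ω f s y) t := by
    intro j hj y
    unfold Grid.avg
    congr 1
    apply setLIntegral_congr_fun (D.meas_cell j t)
    intro s hs
    have hsΩ : s ∈ Ω := by
      rw [hΩ]
      change l < _
      calc l < _ := hk
        _ = N (fun y => D.mx k (fun s => f s y) s) := by
          congr 1; ext y
          exact D.lev_mx k _ t s (D.nest_le hj hs).symm
        _ ≤ _ := hN.mono _ _ fun y => D.mx_le_mx hkK _ s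
    simp [rst, hsΩ]
  have hmain : ∀ A : Y → ℝ≥0∞, Measurable A → N A ≤ l →
      (∀ j < k, ∀ y, D.avg j (fun s => f s y) t ≤ A y) →
      N (fun y => D.mx K (fun s => f s y) t) ≤
      l + N (fun y => D.mx K (fun s => rst Ω f s y) t) := by
    intro A hA hAl hAj
    have hm2 := meas_section' (fun t y => D.mx K (fun s => rst Ω f s y) t) (D.mx_measurable K (rst Ω f) (ind_meas Ω hmΩ f hf)) t
    refine le_trans (hN.mono _ (fun y => A y +
      D.mx K (fun s => rst Ω f s y) t) ?_)
      ((hN.add _ _ hA hm2).trans (by gcongr))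
    intro y
    refine iSup₂_le fun j hj => ?_
    by_cases hjk : j < k
    · exact (hAj j hjk y).trans le_self_add
    · rw [hcell j (not_lt.1 hjk) y]
      exact (D.avg_le_mx hj _ t).trans le_add_self
  rcases k with _ | k
  · exact hmain (fun _ => 0) measurable_const (by rw [hN.zero]; exact zero_le) (by simp)
  · exact hmain (fun y => D.mx k (fun s => f s y) t)
      (meas_section' (fun t y => D.mx k (fun s => f s y) t) (D.mx_measurable k f hf) t)
      (hmin k (Nat.lt_succ_self k)) fun j hj y => D.avg_le_mx (Nat.lt_succ_iff.1 hj) _ t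

theorem bdd_up (hN : GoodNorm N) (p q : ℝ) (hq : 1 < q) (hpq : q < p) (hb : Bdd N q) :
    Bdd N p := by
  obtain ⟨C, hC, hb⟩ := hb
  obtain ⟨C', hC', hg⟩ := good_up p q (by linarith) hpq C hC
  obtain ⟨C2, hC2, hd⟩ := doob p (by linarith)
  refine ⟨C' + 1, by finiteness, fun D K f hf => ?_⟩
  have hGm : Measurable fun t => N (f t) := hN.meas ℝ f hf
  by_cases hfin : ∫⁻ t, N (f t) ^ p = ⊤
  · rw [hfin, ENNReal.mul_top (by simp)]; exact le_top
  have hFm : Measurable fun t => N (fun y => D.mx K (fun s => f s y) t) :=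
    hN.meas ℝ (fun t y => D.mx K (fun s => f s y) t) (D.mx_measurable K f hf)
  refine (hg _ _ hFm hGm ?_ ?_).trans (by gcongr; exact le_self_add)
  · intro l hl
    set Ω := {t | ENNReal.ofReal l < N (fun y => D.mx K (fun s => f s y) t)} with hΩ
    have hmΩ : MeasurableSet Ω := measurableSet_lt measurable_const hFm
    have hf' := ind_meas Ω hmΩ f hf
    have h1 := hb D K (rst Ω f) hf'
    have h2 : ∫⁻ t, N (rst Ω f t) ^ q =
        ∫⁻ t in Ω, N (f t) ^ q := by
      rw [← lintegral_indicator hmΩ]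
      apply lintegral_congr; intro t
      by_cases ht : t ∈ Ω
      · unfold rst
        simp [ht]
      · unfold rst
        simp only [ht, not_false_eq_true, indicator_of_notMem, hN.zero]
        exact ENNReal.zero_rpow_of_pos (by linarith)
    rw [h2] at h1
    refine le_trans ?_ h1
    have hF'm : Measurable fun t =>
        N (fun y => D.mx K (fun s => rst Ω f s y) t) :=
      hN.meas ℝ (fun t y => D.mx K (fun s => rst Ω f s y) t)
        (D.mx_measurable K (rst Ω f) hf')
    refine le_trans ?_ (mul_meas_ge_le_lintegral (hF'm.pow_const q) (ENNReal.ofReal l ^ q))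
    refine mul_le_mul_right (measure_mono ?_) _
    intro t ht
    replace ht : ENNReal.ofReal l < N (fun y => D.mx K (fun s => f s y) t) / 2 := ht
    have htΩ : t ∈ Ω := by
      rw [hΩ, mem_ofPred_eq]
      exact lt_of_lt_of_le ht (ENNReal.div_le_of_le_mul (le_mul_of_one_le_right zero_le (by norm_num)))
    have := up_point hN D K f hf (ENNReal.ofReal l) Ω hΩ t htΩ
    rw [mem_ofPred_eq]
    by_contra hc
    rw [ENNReal.rpow_le_rpow_iff (by linarith), not_le] at hc
    have h3 := this.trans (add_le_add_right hc.le _)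
    have h4 : N (fun y => D.mx K (fun s => f s y) t) / 2 ≤ ENNReal.ofReal l := by
      apply ENNReal.div_le_of_le_mul
      rw [mul_two]; exact h3
    exact absurd ht (not_lt.2 h4)
  · apply ne_of_lt
    calc ∫⁻ t, N (fun y => D.mx K (fun s => f s y) t) ^ p
        ≤ ∫⁻ t, ((K + 1 : ℕ) : ℝ≥0∞) ^ p * D.mx K (fun s => N (f s)) t ^ p := by
          apply lintegral_mono; intro t
          simp only
          rw [← ENNReal.mul_rpow_of_nonneg _ _ (by linarith)]
          exact ENNReal.rpow_le_rpow (hN.apriori D K f hf t) (by linarith)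
      _ = ((K + 1 : ℕ) : ℝ≥0∞) ^ p * ∫⁻ t, D.mx K (fun s => N (f s)) t ^ p :=
          lintegral_const_mul _ ((D.mx_measurable' K _ hGm).pow_const p)
      _ < ⊤ := by
          apply ENNReal.mul_lt_top
          · exact ENNReal.rpow_lt_top_of_nonneg (by linarith) (by simp)
          · exact (D.mx_fin p (by linarith) K _ hGm hfin).lt_top
end

section
variable {Y : Type} [MeasurableSpace Y] {N : (Y → ℝ≥0∞) → ℝ≥0∞}

/-- The Calderon-Zygmund type replacement of `f` at height `l`. -/
def czg (D : Grid) (K : ℕ) (G : ℝ → ℝ≥0∞) (l : ℝ≥0∞) (f : ℝ → Y → ℝ≥0∞) :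
    ℝ → Y → ℝ≥0∞ := fun t y =>
  (∑ k ∈ Finset.range K, (D.stp G l (k + 1)).indicator (fun t => D.avg (k + 1) (fun s => f s y) t) t)
    + {t | D.mx K G t ≤ l}.indicator (fun t => D.avg K (fun s => f s y) t) t

theorem czg_meas (D : Grid) (K : ℕ) (G : ℝ → ℝ≥0∞) (hG : Measurable G) (l : ℝ≥0∞)
    (f : ℝ → Y → ℝ≥0∞) (hf : Measurable (Function.uncurry f)) :
    Measurable (Function.uncurry (czg D K G l f)) := by
  change Measurable fun z : ℝ × Y => czg D K G l f z.1 z.2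
  unfold czg
  apply Measurable.add
  · apply Finset.measurable_sum
    intro k _
    exact ind_meas _ (D.stp_meas G hG l (k + 1)) (fun t y => D.avg (k + 1) (fun s => f s y) t)
      (D.avg_measurable (k + 1) f hf)
  · exact ind_meas _ (measurableSet_le (D.mx_measurable' K G hG) measurable_const)
      (fun t y => D.avg K (fun s => f s y) t) (D.avg_measurable K f hf)

theorem czg_avg (D : Grid) (K : ℕ) (G : ℝ → ℝ≥0∞) (hG : Measurable G) (l : ℝ≥0∞)
    (f : ℝ → Y → ℝ≥0∞) (hf : Measurable (Function.uncurry f)) (t : ℝ) (ht : D.mx K G t ≤ l)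
    (y : Y) (j : ℕ) (hj : j ≤ K) :
    D.avg j (fun s => f s y) t ≤ D.avg j (fun s => czg D K G l f s y) t := by
  unfold Grid.avg
  gcongr (D.w j)⁻¹ * ?_
  have hfy := meas_section f hf y
  have hcm := D.meas_cell j t
  set c : ℝ → ℝ≥0∞ := (D.cell j t).indicator 1 with hc
  have hcl : D.Lev j c := by
    intro s s' e
    by_cases hs : s ∈ D.cell j t
    · have hs' : s' ∈ D.cell j t := e.symm.trans hs
      simp [hc, hs, hs']
    · have hs' : s' ∉ D.cell j t := fun h => hs (e.trans h)
      simp [hc, hs, hs']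
  have hlevi : ∀ (k : ℕ) (S : Set ℝ), (∀ s s', D.idx k s = D.idx k s' → s ∈ S → s' ∈ S) →
      D.Lev k (S.indicator (1 : ℝ → ℝ≥0∞)) := by
    intro k S hS s s' e
    by_cases hs : s ∈ S
    · simp [hs, hS s s' e hs]
    · have : s' ∉ S := fun h => hs (hS s' s e.symm h)
      simp [hs, this]
  have hE : ∀ F : ℝ → ℝ≥0∞, ∫⁻ s in D.cell j t, F s = ∫⁻ s, c s * F s := by
    intro F
    rw [← lintegral_indicator hcm]
    apply lintegral_congr; intro s
    by_cases hs : s ∈ D.cell j t <;> simp [hc, hs]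
  have hno : ∀ k ≤ j, ∀ s ∈ D.cell j t, s ∉ D.stp G l k := by
    intro k hk s hs hsk
    have := D.stp_lev G l k (D.nest_le hk hs) hsk
    exact absurd ((D.stp_iff G l K t).2 ⟨k, hk.trans hj, this⟩) (not_lt.2 ht)
  have hT : ∀ k, ∫⁻ s, c s * (D.stp G l k).indicator (fun t => D.avg k (fun s => f s y) t) s =
      ∫⁻ s, c s * (D.stp G l k).indicator (fun s => f s y) s := by
    intro k
    have hL : D.Lev k (fun s => c s * (D.stp G l k).indicator 1 s) := by
      by_cases hk : k ≤ j
      · intro s s' _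
        have : ∀ s, c s * (D.stp G l k).indicator 1 s = 0 := by
          intro s
          by_cases hs : s ∈ D.cell j t
          · simp [hno k hk s hs]
          · simp [hc, hs]
        simp only [this]
      · intro s s' e
        simp only
        rw [(hcl.up (not_le.1 hk).le) s s' e,
          hlevi k _ (fun s s' e hs => D.stp_lev G l k e hs) s s' e]
    have h1 := D.tower k _ _ hL hfy
    have h2 : ∀ F : ℝ → ℝ≥0∞, ∫⁻ s, c s * (D.stp G l k).indicator F s =
        ∫⁻ s, c s * (D.stp G l k).indicator 1 s * F s := by
      intro F
      apply lintegral_congr; intro s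
      by_cases hs : s ∈ D.stp G l k <;> simp [hs]
    rw [h2, h2]; exact h1
  have hT2 : ∫⁻ s, c s * {t | D.mx K G t ≤ l}.indicator (fun t => D.avg K (fun s => f s y) t) s =
      ∫⁻ s, c s * {t | D.mx K G t ≤ l}.indicator (fun s => f s y) s := by
    have hL : D.Lev K (fun s => c s * {t | D.mx K G t ≤ l}.indicator 1 s) := by
      intro s s' e
      simp only
      rw [(hcl.up hj) s s' e, hlevi K _ (fun s s' e hs => ?_) s s' e]
      rw [mem_ofPred_eq] at hs ⊢
      rwa [← D.lev_mx K G s s' e]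
    have h1 := D.tower K _ _ hL hfy
    have h2 : ∀ F : ℝ → ℝ≥0∞, ∫⁻ s, c s * {t | D.mx K G t ≤ l}.indicator F s =
        ∫⁻ s, c s * {t | D.mx K G t ≤ l}.indicator 1 s * F s := by
      intro F
      apply lintegral_congr; intro s
      by_cases hs : s ∈ {t | D.mx K G t ≤ l} 
      · rw [indicator_of_mem hs, indicator_of_mem hs]; simp
      · rw [indicator_of_notMem hs, indicator_of_notMem hs]; simp
    rw [h2, h2]; exact h1
  have hcM : Measurable c := measurable_one.indicator hcm
  have hsetm : MeasurableSet {t | D.mx K G t ≤ l} :=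
    measurableSet_le (D.mx_measurable' K G hG) measurable_const
  have e1 : ∫⁻ s, c s * czg D K G l f s y =
      ∫⁻ s, ((∑ k ∈ Finset.range K, c s * (D.stp G l (k + 1)).indicator (fun s => f s y) s)
        + c s * {t | D.mx K G t ≤ l}.indicator (fun s => f s y) s) := by
    unfold czg
    simp_rw [mul_add, Finset.mul_sum]
    rw [lintegral_add_right, lintegral_add_right, lintegral_finsetSum, lintegral_finsetSum, hT2]
    · simp_rw [hT]
    · intro k _
      exact hcM.mul (hfy.indicator (D.stp_meas G hG l (k + 1)))
    · intro k _
      exact hcM.mul ((D.avg_measurable' (k + 1) _ hfy).indicator (D.stp_meas G hG l (k + 1)))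
    · exact hcM.mul (hfy.indicator hsetm)
    · exact hcM.mul ((D.avg_measurable' K _ hfy).indicator hsetm)
  rw [hE, hE, e1]
  apply lintegral_mono
  intro s
  simp only
  by_cases hs : s ∈ D.cell j t
  swap
  · simp [hc, hs]
  by_cases hsl : D.mx K G s ≤ l
  · refine le_trans ?_ le_add_self
    rw [indicator_of_mem (show s ∈ {t | D.mx K G t ≤ l} from hsl)]
  · refine le_trans ?_ le_self_add
    obtain ⟨k, hk, hsk⟩ := (D.stp_iff G l K s).1 (not_le.1 hsl)
    rcases k with _ | k
    · exact absurd hsk (hno 0 (Nat.zero_le _) s hs)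
    · refine le_trans ?_ (Finset.single_le_sum
        (f := fun k => c s * (D.stp G l (k + 1)).indicator (fun s => f s y) s)
        (fun _ _ => zero_le) (Finset.mem_range.2 hk))
      rw [indicator_of_mem hsk]

theorem czg_norm (hN : GoodNorm N) (D : Grid) (K : ℕ) (l : ℝ≥0∞)
    (f : ℝ → Y → ℝ≥0∞) (hf : Measurable (Function.uncurry f)) (t : ℝ) :
    N (czg D K (fun s => N (f s)) l f t) ≤ min (2 * l) (D.mx K (fun s => N (f s)) t) := by
  set G := fun s => N (f s) with hG
  by_cases ht : D.mx K G t ≤ l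
  · have : czg D K G l f t = fun y => D.avg K (fun s => f s y) t := by
      ext y
      unfold czg
      rw [indicator_of_mem (show t ∈ {t | D.mx K G t ≤ l} from ht), Finset.sum_eq_zero, zero_add]
      intro k hk
      apply indicator_of_notMem
      intro hs
      exact absurd ((D.stp_iff G l K t).2 ⟨k + 1, Finset.mem_range.1 hk, hs⟩) (not_lt.2 ht)
    rw [this]
    have h1 := (hN.avg D K f hf t).trans (D.avg_le_mx le_rfl G t)
    refine le_min (h1.trans (ht.trans ?_)) h1
    exact le_mul_of_one_le_left zero_le (by norm_num)
  · obtain ⟨k, hk, hsk⟩ := (D.stp_iff G l K t).1 (not_le.1 ht)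
    have hnot : t ∉ {t | D.mx K G t ≤ l} := ht
    rcases k with _ | k
    · have : czg D K G l f t = fun y => 0 := by
        ext y
        unfold czg
        rw [indicator_of_notMem hnot, Finset.sum_eq_zero, zero_add]
        intro k hk
        apply indicator_of_notMem
        intro hs
        have := D.stp_unique G l hs hsk
        omega
      rw [this, hN.zero]; exact zero_le
    · have : czg D K G l f t = fun y => D.avg (k + 1) (fun s => f s y) t := by
        ext y
        unfold czg
        rw [indicator_of_notMem hnot, add_zero, Finset.sum_eq_single k, indicator_of_mem hsk]
        · intro j hj hjk
          apply indicator_of_notMem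
          intro hs
          have := D.stp_unique G l hs hsk
          omega
        · intro h
          exact absurd (Finset.mem_range.2 hk) h
      rw [this]
      have h1 := hN.avg D (k + 1) f hf t
      refine le_min (h1.trans ((D.avg_dbl k G t).trans ?_)) (h1.trans (D.avg_le_mx hk G t))
      gcongr
      exact hsk.2 k (Nat.lt_succ_self k)

theorem bdd_down (hN : GoodNorm N) (p q : ℝ) (hp : 1 < p) (hpq : p < q) (hb : Bdd N q) :
    Bdd N p := by
  obtain ⟨C, hC, hb⟩ := hb
  obtain ⟨C', hC', hg⟩ := good_down p q (by linarith) hpq C hC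
  obtain ⟨C2, hC2, hd⟩ := doob p (by linarith)
  refine ⟨C' * C2, by finiteness, fun D K f hf => ?_⟩
  have hGm : Measurable fun t => N (f t) := hN.meas ℝ f hf
  have hFm : Measurable fun t => N (fun y => D.mx K (fun s => f s y) t) :=
    hN.meas ℝ (fun t y => D.mx K (fun s => f s y) t) (D.mx_measurable K f hf)
  refine (hg _ (D.mx K (fun t => N (f t))) hFm (D.mx_measurable' K _ hGm) ?_).trans ?_
  swap
  · rw [mul_assoc]
    gcongr
    exact hd D K _ hGm
  intro l hl
  set L := ENNReal.ofReal l with hL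
  set G := fun t => N (f t) with hG
  have hcm := czg_meas D K G hGm L f hf
  have hF'm : Measurable fun t => N (fun y => D.mx K (fun s => czg D K G L f s y) t) :=
    hN.meas ℝ (fun t y => D.mx K (fun s => czg D K G L f s y) t) (D.mx_measurable K _ hcm)
  have hsub : {t | L < N (fun y => D.mx K (fun s => f s y) t)} ⊆ {t | L < D.mx K G t} ∪
      {t | L ^ q ≤ N (fun y => D.mx K (fun s => czg D K G L f s y) t) ^ q} := by
    intro t ht
    rw [mem_ofPred_eq] at ht
    by_cases h : L < D.mx K G t
    · left; exact h
    · right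
      rw [mem_ofPred_eq]
      apply ENNReal.rpow_le_rpow _ (by linarith)
      refine ht.le.trans (hN.mono _ _ fun y => ?_)
      exact iSup₂_le fun j hj => (czg_avg D K G hGm L f hf t (not_lt.1 h) y j hj).trans
        (D.avg_le_mx hj _ t)
  refine (measure_mono hsub).trans ((measure_union_le _ _).trans ?_)
  gcongr
  have h1 := mul_meas_ge_le_lintegral (μ := volume) (hF'm.pow_const q) (L ^ q)
  have h2 := h1.trans (hb D K _ hcm)
  have h3 : ∫⁻ t, N (czg D K G L f t) ^ q ≤ ∫⁻ t, min (2 * L) (D.mx K G t) ^ q := by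
    apply lintegral_mono; intro t
    exact ENNReal.rpow_le_rpow (czg_norm hN D K L f hf t) (by linarith)
  have h4 : ENNReal.ofReal (l ^ (-q)) * L ^ q = 1 := by
    rw [hL, ENNReal.ofReal_rpow_of_pos hl, ← ENNReal.ofReal_mul (by positivity),
      ← Real.rpow_add hl]
    simp
  calc _ = ENNReal.ofReal (l ^ (-q)) * (L ^ q *
        volume {t | L ^ q ≤ N (fun y => D.mx K (fun s => czg D K G L f s y) t) ^ q}) := by
        rw [← mul_assoc, h4, one_mul]
    _ ≤ ENNReal.ofReal (l ^ (-q)) * (C * ∫⁻ t, min (2 * L) (D.mx K G t) ^ q) := by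
        exact mul_le_mul_right (h2.trans (mul_le_mul_right h3 _)) _
    _ = _ := by ring
end

theorem bdd_any {Y : Type} [MeasurableSpace Y] {N : (Y → ℝ≥0∞) → ℝ≥0∞} (hN : GoodNorm N)
    (p q : ℝ) (hp : 1 < p) (hq : 1 < q) (hb : Bdd N q) : Bdd N p := by
  rcases lt_trichotomy p q with h | h | h
  · exact bdd_down hN p q hp h hb
  · rwa [h]
  · exact bdd_up hN p q hq h hb

theorem bdd_mixed (n : ℕ) (q : Fin n → ℝ) (hq : ∀ i, 1 < q i) (p : ℝ) (hp : 1 < p) :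
    Bdd (mixedLnorm n q) p := by
  induction n generalizing p with
  | zero =>
    obtain ⟨C, hC, h⟩ := doob p hp
    refine ⟨C, hC, fun D K f hf => ?_⟩
    simp only [mixedLnorm_zero]
    exact h D K _ (meas_section f hf _)
  | succ n ih =>
    refine bdd_any (mixedLnorm_good (n + 1) q fun i => (hq i).le) p (q (Fin.last n)) hp (hq _) ?_
    have hlast := hq (Fin.last n)
    obtain ⟨C, hC, h⟩ := ih (fun i => q i.castSucc) (fun i => hq _) (q (Fin.last n)) hlast
    refine ⟨C, hC, fun D K f hf => ?_⟩
    set r := q (Fin.last n) with hr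
    have hr0 : r ≠ 0 := by linarith
    have hpow : ∀ g, mixedLnorm (n + 1) q g ^ r =
        ∫⁻ u : ℝ, mixedLnorm n (fun i => q i.castSucc) (fun y => g (Fin.snoc y u)) ^ r := by
      intro g
      rw [mixedLnorm_succ, ← ENNReal.rpow_mul, one_div_mul_cancel hr0, ENNReal.rpow_one]
    simp only [hpow]
    have hms := measurable_snoc n
    have hF : Measurable fun z : (ℝ × ℝ) × (Fin n → ℝ) => f z.1.1 (Fin.snoc z.2 z.1.2) :=
      hf.comp ((measurable_fst.comp measurable_fst).prodMk
        (hms.comp (measurable_snd.prodMk (measurable_snd.comp measurable_fst))))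
    have hM0 := D.mx_measurable K f hf
    have hM : Measurable fun z : (ℝ × ℝ) × (Fin n → ℝ) =>
        D.mx K (fun s => f s (Fin.snoc z.2 z.1.2)) z.1.1 :=
      hM0.comp (f := fun z : (ℝ × ℝ) × (Fin n → ℝ) =>
        (z.1.1, (Fin.snoc z.2 z.1.2 : Fin (n + 1) → ℝ)))
        ((measurable_fst.comp measurable_fst).prodMk (hms.comp (measurable_snd.prodMk (measurable_snd.comp measurable_fst))))
    have hg := mixedLnorm_meas n (fun i => q i.castSucc)
    have m1 := (hg (ℝ × ℝ) (fun z y => f z.1 (Fin.snoc y z.2)) hF).pow_const r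
    have m2 := (hg (ℝ × ℝ) (fun z y => D.mx K (fun s => f s (Fin.snoc y z.2)) z.1) hM).pow_const r
    have sw := lintegral_lintegral_swap (μ := volume) (ν := volume) (f := fun t u =>
      mixedLnorm n (fun i => q i.castSucc) (fun y => f t (Fin.snoc y u)) ^ r) m1.aemeasurable
    rw [lintegral_lintegral_swap m2.aemeasurable, sw, ← lintegral_const_mul]
    · apply lintegral_mono
      intro u
      refine h D K (fun s y => f s (Fin.snoc y u)) ?_
      exact hf.comp (measurable_fst.prodMk (hms.comp (measurable_snd.prodMk measurable_const)))
    · exact (m1.comp measurable_swap).lintegral_prod_right'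

theorem floor_half (a : ℝ) : ⌊a⌋ = ⌊2 * a⌋ / 2 := by
  have h1 := Int.floor_le a
  have h2 := Int.lt_floor_add_one a
  have h3 : 2 * ⌊a⌋ ≤ ⌊2 * a⌋ := by
    rw [Int.le_floor]; push_cast; linarith
  have h4 : ⌊2 * a⌋ < 2 * ⌊a⌋ + 2 := by
    rw [Int.floor_lt]; push_cast; linarith
  omega

/-- Shifted dyadic grid, with base cells of length `L`. -/
def dgrid (L τ : ℝ) (hL : 0 < L) : Grid where
  idx k t := ⌊(t - τ) / (L / 2 ^ k)⌋
  w k := ENNReal.ofReal (L / 2 ^ k)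
  meas k := Int.measurable_floor.comp (by fun_prop)
  nest k s t h := by
    have e : ∀ s : ℝ, (s - τ) / (L / 2 ^ (k + 1)) = 2 * ((s - τ) / (L / 2 ^ k)) := by
      intro s; field_simp; ring
    rw [e, e] at h
    rw [floor_half, h, ← floor_half]
  vol k t := by
    set c := L / 2 ^ k with hc
    have hcp : 0 < c := by positivity
    have : {s : ℝ | ⌊(s - τ) / c⌋ = ⌊(t - τ) / c⌋} =
        Ico (τ + ⌊(t - τ) / c⌋ * c) (τ + (⌊(t - τ) / c⌋ + 1) * c) := by
      ext s
      rw [mem_ofPred_eq, Int.floor_eq_iff, le_div_iff₀ hcp, div_lt_iff₀ hcp, mem_Ico]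
      constructor <;> rintro ⟨h1, h2⟩ <;> constructor <;> linarith
    rw [this, Real.volume_Ico]
    congr 1; ring
  wpos k := by
    have : 0 < L / 2 ^ k := by positivity
    simpa using this
  wfin k := by simp
  dbl k := by
    rw [show (2 : ℝ≥0∞) = ENNReal.ofReal 2 by simp, ← ENNReal.ofReal_mul (by norm_num)]
    apply ENNReal.ofReal_le_ofReal
    apply le_of_eq
    field_simp; ring

theorem floor_sep (c s t : ℝ) (hc : 0 < c) (h : ⌊s / c⌋ ≠ ⌊t / c⌋) :
    ∃ a : ℤ, |a * c - t| ≤ |s - t| := by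
  have s1 := Int.floor_le (s / c)
  have s2 := Int.lt_floor_add_one (s / c)
  have t1 := Int.floor_le (t / c)
  have t2 := Int.lt_floor_add_one (t / c)
  rw [le_div_iff₀ hc] at s1 t1
  rw [div_lt_iff₀ hc] at s2 t2
  rcases lt_or_gt_of_ne h with h | h
  · have : ((⌊s / c⌋ : ℝ) + 1) ≤ ⌊t / c⌋ := by exact_mod_cast h
    have h3 := mul_le_mul_of_nonneg_right this hc.le
    refine ⟨⌊t / c⌋, ?_⟩
    rw [abs_of_nonpos (by linarith), abs_of_nonpos (by linarith)]
    linarith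
  · have : ((⌊t / c⌋ : ℝ) + 1) ≤ ⌊s / c⌋ := by exact_mod_cast h
    have h3 := mul_le_mul_of_nonneg_right this hc.le
    refine ⟨⌊s / c⌋, ?_⟩
    rw [abs_of_nonneg (by linarith), abs_of_nonneg (by linarith)]
    linarith

theorem one_third (L : ℝ) (hL : 0 < L) (k : ℕ) (r : ℝ) (hr : 6 * r ≤ L / 2 ^ k) (t : ℝ) :
    Ioo (t - r) (t + r) ⊆ (dgrid L 0 hL).cell k t ∨
    Ioo (t - r) (t + r) ⊆ (dgrid L (L / 3) hL).cell k t := by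
  by_contra hcon
  rw [not_or, not_subset, not_subset] at hcon
  obtain ⟨⟨s, hs, hs'⟩, ⟨u, hu, hu'⟩⟩ := hcon
  set c := L / 2 ^ k with hc
  have hcp : 0 < c := by positivity
  have hLc : L = c * 2 ^ k := by rw [hc]; field_simp
  obtain ⟨a, ha⟩ := floor_sep c (s - 0) (t - 0) hcp hs'
  obtain ⟨b, hb⟩ := floor_sep c (u - L / 3) (t - L / 3) hcp hu'
  have h1 : |s - 0 - (t - 0)| < r := by
    rw [abs_lt]; constructor <;> linarith [hs.1, hs.2]
  have h2 : |u - L / 3 - (t - L / 3)| < r := by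
    rw [abs_lt]; constructor <;> linarith [hu.1, hu.2]
  have h3 := abs_lt.1 (ha.trans_lt h1)
  have h4 := abs_lt.1 (hb.trans_lt h2)
  have h5 : |(3 * (a - b) - 2 ^ k : ℝ) * c| < 1 * c := by
    rw [abs_lt, sub_mul, mul_comm (2 ^ k : ℝ) c, ← hLc]
    constructor <;> nlinarith
  rw [abs_mul, abs_of_pos hcp] at h5
  have h6 := lt_of_mul_lt_mul_right h5 hcp.le
  have h7 : |(3 * (a - b) - 2 ^ k : ℤ)| < 1 := by exact_mod_cast h6
  rw [Int.abs_lt_one_iff] at h7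
  have h8 : (3 : ℤ) ∣ 2 ^ k := ⟨a - b, by linarith⟩
  have h9 : (3 : ℤ) ∣ 2 := Int.Prime.dvd_pow' (by norm_num) (by exact_mod_cast h8)
  norm_num at h9

def A1 (j : ℤ) (g : ℝ → ℝ≥0∞) (t : ℝ) : ℝ≥0∞ :=
  (ENNReal.ofReal (2 * 2 ^ j))⁻¹ * ∫⁻ s in Ioo (t - 2 ^ j) (t + 2 ^ j), g s

def MT (J : ℕ) (g : ℝ → ℝ≥0∞) (t : ℝ) : ℝ≥0∞ := ⨆ (j : ℤ) (_ : |j| ≤ J), A1 j g t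

def M1 (g : ℝ → ℝ≥0∞) (t : ℝ) : ℝ≥0∞ := ⨆ J : ℕ, MT J g t

theorem A1_le_M1 (j : ℤ) (g : ℝ → ℝ≥0∞) (t : ℝ) : A1 j g t ≤ M1 g t :=
  le_iSup_of_le j.natAbs (le_iSup₂_of_le j (by simp) le_rfl)

theorem MT_mono (g : ℝ → ℝ≥0∞) (t : ℝ) : Monotone fun J => MT J g t := fun _ _ h =>
  iSup₂_le fun j hj => le_iSup₂_of_le j (hj.trans (by exact_mod_cast h)) le_rfl

theorem A1_measurable {T : Type} [MeasurableSpace T] (j : ℤ) (f : ℝ → T → ℝ≥0∞)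
    (hf : Measurable (Function.uncurry f)) :
    Measurable fun z : ℝ × T => A1 j (fun s => f s z.2) z.1 := by
  unfold A1
  apply Measurable.const_mul
  have : ∀ z : ℝ × T, ∫⁻ s in Ioo (z.1 - 2 ^ j) (z.1 + 2 ^ j), f s z.2 =
      ∫⁻ s, {w : (ℝ × T) × ℝ | w.1.1 - 2 ^ j < w.2 ∧ w.2 < w.1.1 + 2 ^ j}.indicator
        (fun w => f w.2 w.1.2) (z, s) := by
    intro z
    rw [← lintegral_indicator measurableSet_Ioo]
    rfl
  simp only [this]
  apply Measurable.lintegral_prod_right' (f := fun w : (ℝ × T) × ℝ =>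
    {w : (ℝ × T) × ℝ | w.1.1 - 2 ^ j < w.2 ∧ w.2 < w.1.1 + 2 ^ j}.indicator
        (fun w => f w.2 w.1.2) w)
  apply Measurable.indicator
  · exact hf.comp (measurable_snd.prodMk (measurable_snd.comp measurable_fst))
  · apply MeasurableSet.inter
    · exact measurableSet_lt ((measurable_fst.comp measurable_fst).sub_const _) measurable_snd
    · exact measurableSet_lt measurable_snd ((measurable_fst.comp measurable_fst).add_const _)

theorem MT_measurable {T : Type} [MeasurableSpace T] (J : ℕ) (f : ℝ → T → ℝ≥0∞)
    (hf : Measurable (Function.uncurry f)) :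
    Measurable fun z : ℝ × T => MT J (fun s => f s z.2) z.1 := by
  unfold MT
  exact Measurable.iSup fun j => Measurable.iSup fun _ => A1_measurable j f hf

theorem M1_measurable {T : Type} [MeasurableSpace T] (f : ℝ → T → ℝ≥0∞)
    (hf : Measurable (Function.uncurry f)) :
    Measurable fun z : ℝ × T => M1 (fun s => f s z.2) z.1 := by
  unfold M1
  exact Measurable.iSup fun J => MT_measurable J f hf

theorem eight_pos (J : ℕ) : (0 : ℝ) < 8 * 2 ^ J := by positivity

def gA (J : ℕ) : Grid := dgrid (8 * 2 ^ J) 0 (eight_pos J)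
def gB (J : ℕ) : Grid := dgrid (8 * 2 ^ J) (8 * 2 ^ J / 3) (eight_pos J)

theorem MT_le (J : ℕ) (g : ℝ → ℝ≥0∞) (t : ℝ) :
    MT J g t ≤ 4 * ((gA J).mx (2 * J) g t + (gB J).mx (2 * J) g t) := by
  refine iSup₂_le fun j hj => ?_
  rw [abs_le] at hj
  obtain ⟨k, hk⟩ : ∃ k : ℕ, (k : ℤ) = J - j := ⟨(J - j).toNat, by omega⟩
  have hkJ : k ≤ 2 * J := by omega
  have hj2 : j = J - k := by omega
  have hlen : (8 * 2 ^ J / 2 ^ k : ℝ) = 8 * 2 ^ j := by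
    rw [hj2, zpow_sub₀ (by norm_num), zpow_natCast, zpow_natCast]; ring
  have hpos : (0 : ℝ) < 2 ^ j := by positivity
  have hw : ∀ τ, (ENNReal.ofReal (2 * 2 ^ j))⁻¹ = 4 * ((dgrid (8 * 2 ^ J) τ (eight_pos J)).w k)⁻¹ := by
    intro τ
    change _ = 4 * (ENNReal.ofReal (8 * 2 ^ J / 2 ^ k))⁻¹
    rw [hlen, ← ENNReal.ofReal_inv_of_pos (by positivity), ← ENNReal.ofReal_inv_of_pos (by positivity),
      show (4 : ℝ≥0∞) = ENNReal.ofReal 4 by simp, ← ENNReal.ofReal_mul (by norm_num)]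
    congr 1
    field_simp; norm_num
  have key : ∀ τ, Ioo (t - 2 ^ j) (t + 2 ^ j) ⊆ (dgrid (8 * 2 ^ J) τ (eight_pos J)).cell k t →
      A1 j g t ≤ 4 * (dgrid (8 * 2 ^ J) τ (eight_pos J)).mx (2 * J) g t := by
    intro τ h
    unfold A1
    rw [hw τ, mul_assoc]
    gcongr
    refine le_trans ?_ (Grid.avg_le_mx _ hkJ g t)
    unfold Grid.avg
    gcongr
  rcases one_third (8 * 2 ^ J) (eight_pos J) k (2 ^ j) (by rw [hlen]; linarith) t with h | h
  · exact (key _ h).trans (by gcongr; exact le_self_add)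
  · exact (key _ h).trans (by gcongr; exact le_add_self)

theorem M1_bdd {Y : Type} [MeasurableSpace Y] {N : (Y → ℝ≥0∞) → ℝ≥0∞} (hN : GoodNorm N)
    (p : ℝ) (hp : 1 < p) (hb : Bdd N p) : ∃ C : ℝ≥0∞, C ≠ ⊤ ∧ ∀ f : ℝ → Y → ℝ≥0∞,
    Measurable (Function.uncurry f) →
    ∫⁻ t, N (fun y => M1 (fun s => f s y) t) ^ p ≤ C * ∫⁻ t, N (f t) ^ p := by
  obtain ⟨C, hC, hb⟩ := hb
  have hp0 : 0 < p := by linarith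
  refine ⟨4 ^ p * (2 ^ (p - 1) * (C + C)), ?_, fun f hf => ?_⟩
  · apply ENNReal.mul_ne_top (ENNReal.rpow_ne_top_of_nonneg hp0.le (by simp))
    apply ENNReal.mul_ne_top (ENNReal.rpow_ne_top_of_nonneg (by linarith) (by simp))
    finiteness
  have hm : ∀ (D : Grid) K, Measurable fun t => N (fun y => D.mx K (fun s => f s y) t) :=
    fun D K => hN.meas ℝ (fun t y => D.mx K (fun s => f s y) t) (D.mx_measurable K f hf)
  have hms : ∀ (D : Grid) K t, Measurable fun y => D.mx K (fun s => f s y) t := fun D K t =>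
    meas_section' (fun t y => D.mx K (fun s => f s y) t) (D.mx_measurable K f hf) t
  have hJ : ∀ J, ∫⁻ t, N (fun y => MT J (fun s => f s y) t) ^ p ≤
      4 ^ p * (2 ^ (p - 1) * (C + C)) * ∫⁻ t, N (f t) ^ p := by
    intro J
    calc ∫⁻ t, N (fun y => MT J (fun s => f s y) t) ^ p
        ≤ ∫⁻ t, 4 ^ p * (2 ^ (p - 1) * (N (fun y => (gA J).mx (2 * J) (fun s => f s y) t) ^ p +
          N (fun y => (gB J).mx (2 * J) (fun s => f s y) t) ^ p)) := by
          apply lintegral_mono; intro t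
          have h1 := (hN.mono _ _ fun y => MT_le J (fun s => f s y) t).trans
            ((hN.smul 4 _ ((hms (gA J) (2 * J) t).add (hms (gB J) (2 * J) t))).trans
            (mul_le_mul_right (hN.add _ _ (hms (gA J) (2 * J) t) (hms (gB J) (2 * J) t)) 4))
          refine (ENNReal.rpow_le_rpow h1 hp0.le).trans ?_
          rw [ENNReal.mul_rpow_of_nonneg _ _ hp0.le]
          exact mul_le_mul_right (ENNReal.rpow_add_le_mul_rpow_add_rpow _ _ hp.le) _
      _ = 4 ^ p * (2 ^ (p - 1) * ((∫⁻ t, N (fun y => (gA J).mx (2 * J) (fun s => f s y) t) ^ p) +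
          ∫⁻ t, N (fun y => (gB J).mx (2 * J) (fun s => f s y) t) ^ p)) := by
          have m1 := (hm (gA J) (2 * J)).pow_const p
          have m2 := (hm (gB J) (2 * J)).pow_const p
          rw [lintegral_const_mul' _ _ (ENNReal.rpow_ne_top_of_nonneg hp0.le (by simp)),
            lintegral_const_mul' _ _ (ENNReal.rpow_ne_top_of_nonneg (by linarith) (by simp)),
            lintegral_add_left m1]
      _ ≤ 4 ^ p * (2 ^ (p - 1) * (C * (∫⁻ t, N (f t) ^ p) + C * ∫⁻ t, N (f t) ^ p)) :=
          mul_le_mul_right (mul_le_mul_right (add_le_add (hb _ _ f hf) (hb _ _ f hf)) _) _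
      _ = _ := by ring
  have hMm : ∀ J, Measurable fun t => N (fun y => MT J (fun s => f s y) t) := fun J =>
    hN.meas ℝ (fun t y => MT J (fun s => f s y) t) (MT_measurable J f hf)
  calc ∫⁻ t, N (fun y => M1 (fun s => f s y) t) ^ p
      ≤ ∫⁻ t, ⨆ J, N (fun y => MT J (fun s => f s y) t) ^ p := by
        apply lintegral_mono; intro t
        have h1 := hN.sup (fun J y => MT J (fun s => f s y) t)
          (fun _ _ h y => MT_mono _ t h)
          (fun J => meas_section' (fun t y => MT J (fun s => f s y) t) (MT_measurable J f hf) t)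
        refine (ENNReal.rpow_le_rpow h1 hp0.le).trans (le_of_eq ?_)
        exact (ENNReal.orderIsoRpow p hp0).map_iSup _
    _ = ⨆ J, ∫⁻ t, N (fun y => MT J (fun s => f s y) t) ^ p := by
        apply lintegral_iSup fun J => (hMm J).pow_const p
        intro _ _ h t
        exact ENNReal.rpow_le_rpow (hN.mono _ _ fun y => MT_mono _ t h) hp0.le
    _ ≤ _ := iSup_le hJ

def SM : (n : ℕ) → ((Fin n → ℝ) → ℝ≥0∞) → (Fin n → ℝ) → ℝ≥0∞
  | 0, f => f
  | (n + 1), f => fun x =>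
      M1 (fun s => SM n (fun y => f (Fin.snoc y s)) (Fin.init x)) (x (Fin.last n))

theorem measurable_init (n : ℕ) :
    Measurable fun x : Fin (n + 1) → ℝ => (Fin.init x : Fin n → ℝ) := by
  rw [measurable_pi_iff]
  intro i
  exact measurable_pi_apply _

theorem SM_measurable (n : ℕ) (T : Type) [MeasurableSpace T] (f : T → (Fin n → ℝ) → ℝ≥0∞)
    (hf : Measurable (Function.uncurry f)) :
    Measurable fun z : T × (Fin n → ℝ) => SM n (f z.1) z.2 := by
  induction n generalizing T with
  | zero => exact hf
  | succ n ih =>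
    simp only [SM]
    have hms := measurable_snoc n
    have h1 := ih (ℝ × T) (fun z y => f z.2 (Fin.snoc y z.1))
      (hf.comp (g := Function.uncurry f)
        (f := fun w : (ℝ × T) × (Fin n → ℝ) => (w.1.2, (Fin.snoc w.2 w.1.1 : Fin (n + 1) → ℝ)))
        ((measurable_snd.comp measurable_fst).prodMk
        (hms.comp (measurable_snd.prodMk (measurable_fst.comp measurable_fst)))))
    have h2 := M1_measurable (T := T × (Fin n → ℝ))
      (fun s z => SM n (fun y => f z.1 (Fin.snoc y s)) z.2)
      (h1.comp (f := fun w : ℝ × (T × (Fin n → ℝ)) => ((w.1, w.2.1), w.2.2))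
      ((measurable_fst.prodMk (measurable_fst.comp measurable_snd)).prodMk
        (measurable_snd.comp measurable_snd)))
    exact h2.comp (f := fun z : T × (Fin (n + 1) → ℝ) => (z.2 (Fin.last n), (z.1, Fin.init z.2)))
      (((measurable_pi_apply _).comp measurable_snd).prodMk
      (measurable_fst.prodMk ((measurable_init n).comp measurable_snd)))

theorem SM_bdd (n : ℕ) (q : Fin n → ℝ) (hq : ∀ i, 1 < q i) : ∃ C : ℝ≥0∞, C ≠ ⊤ ∧
    ∀ f : (Fin n → ℝ) → ℝ≥0∞, Measurable f →
      mixedLnorm n q (SM n f) ≤ C * mixedLnorm n q f := by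
  induction n with
  | zero => exact ⟨1, by simp, fun f _ => by simp [SM]⟩
  | succ n ih =>
    set r := q (Fin.last n) with hr
    have hr1 : 1 < r := hq _
    have hr0 : 0 < r := by linarith
    obtain ⟨C1, hC1, h1⟩ := ih (fun i => q i.castSucc) fun i => hq _
    obtain ⟨C2, hC2, h2⟩ := M1_bdd (mixedLnorm_good n (fun i => q i.castSucc) fun i => (hq _).le)
      r hr1 (bdd_mixed n _ (fun i => hq _) r hr1)
    refine ⟨(C2 * C1 ^ r) ^ (1 / r), ?_, fun f hf => ?_⟩
    · apply ENNReal.rpow_ne_top_of_nonneg (by positivity)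
      exact ENNReal.mul_ne_top hC2 (ENNReal.rpow_ne_top_of_nonneg hr0.le hC1)
    have hms := measurable_snoc n
    have hfs : Measurable (Function.uncurry fun (t : ℝ) (y : Fin n → ℝ) => f (Fin.snoc y t)) :=
      hf.comp (hms.comp measurable_swap)
    have hfn := mixedLnorm_meas n (fun i => q i.castSucc) ℝ _ hfs
    rw [mixedLnorm_succ, mixedLnorm_succ, ← ENNReal.mul_rpow_of_nonneg _ _ (by positivity)]
    apply ENNReal.rpow_le_rpow _ (by positivity)
    simp only [SM, Fin.init_snoc, Fin.snoc_last]
    refine (h2 (fun s y => SM n (fun y => f (Fin.snoc y s)) y) ?_).trans ?_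
    · exact SM_measurable n ℝ (fun s y => f (Fin.snoc y s)) hfs
    rw [mul_assoc, ← lintegral_const_mul _ (hfn.pow_const r)]
    gcongr with t
    rw [← ENNReal.mul_rpow_of_nonneg _ _ hr0.le]
    apply ENNReal.rpow_le_rpow _ hr0.le
    exact h1 _ (meas_section' _ hfs t)

theorem lintegral_snoc (n : ℕ) (g : (Fin (n + 1) → ℝ) → ℝ≥0∞) (hg : Measurable g) :
    ∫⁻ x, g x = ∫⁻ t : ℝ, ∫⁻ y : Fin n → ℝ, g (Fin.snoc y t) := by
  have h := (volume_preserving_piFinSuccAbove (fun _ : Fin (n + 1) => ℝ) (Fin.last n)).symm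
  rw [← h.lintegral_comp hg]
  have hm : Measurable fun z => g ((MeasurableEquiv.piFinSuccAbove (fun _ : Fin (n + 1) => ℝ)
      (Fin.last n)).symm z) := hg.comp (MeasurableEquiv.measurable _)
  have h2 := lintegral_prod (μ := (volume : Measure ℝ)) (ν := (volume : Measure (Fin n → ℝ)))
    (fun z => g ((MeasurableEquiv.piFinSuccAbove (fun _ : Fin (n + 1) => ℝ)
      (Fin.last n)).symm z)) hm.aemeasurable
  refine h2.trans ?_
  apply lintegral_congr; intro t
  apply lintegral_congr; intro y
  congr 1
  exact Fin.insertNth_last' t y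

theorem mixedLnorm_one (n : ℕ) (g : (Fin n → ℝ) → ℝ≥0∞) (hg : Measurable g) :
    mixedLnorm n (fun _ => 1) g = ∫⁻ x, g x := by
  induction n with
  | zero =>
    rw [mixedLnorm_zero, Measure.volume_pi_eq_dirac (fun i : Fin 0 => i.elim0),
      lintegral_dirac' _ hg]
  | succ n ih =>
    rw [mixedLnorm_succ, lintegral_snoc n g hg]
    simp only [ENNReal.rpow_one, div_one]
    apply lintegral_congr; intro t
    exact ih _ (hg.comp ((measurable_snoc n).comp (measurable_id.prodMk measurable_const)))

def cube (n : ℕ) (x : Fin n → ℝ) (r : ℝ) : Set (Fin n → ℝ) := {y | ∀ i, |y i - x i| < r}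

theorem cube_meas (n : ℕ) (x : Fin n → ℝ) (r : ℝ) : MeasurableSet (cube n x r) := by
  have : cube n x r = ⋂ i, {y | |y i - x i| < r} := by ext y; simp [cube]
  rw [this]
  refine MeasurableSet.iInter fun i => measurableSet_lt ?_ measurable_const
  fun_prop

theorem cube_snoc (n : ℕ) (x : Fin (n + 1) → ℝ) (r : ℝ) (y : Fin n → ℝ) (t : ℝ) :
    Fin.snoc y t ∈ cube (n + 1) x r ↔ y ∈ cube n (Fin.init x) r ∧
      t ∈ Ioo (x (Fin.last n) - r) (x (Fin.last n) + r) := by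
  rw [cube, mem_ofPred_eq, Fin.forall_fin_succ', Fin.snoc_last, abs_lt, cube, mem_ofPred_eq, mem_Ioo]
  apply and_congr
  · apply forall_congr'; intro i
    simp [Fin.init]
  · constructor <;> rintro ⟨h1, h2⟩ <;> constructor <;> linarith

theorem cube_avg (n : ℕ) (x : Fin n → ℝ) (j : ℤ) (f : (Fin n → ℝ) → ℝ≥0∞) (hf : Measurable f) :
    (ENNReal.ofReal (2 * 2 ^ j))⁻¹ ^ n * ∫⁻ y in cube n x (2 ^ j), f y ≤ SM n f x := by
  induction n with
  | zero =>
    rw [pow_zero, one_mul]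
    refine (setLIntegral_le_lintegral _ _).trans ?_
    rw [Measure.volume_pi_eq_dirac x, lintegral_dirac' _ hf]
    rfl
  | succ n ih =>
    have hms := measurable_snoc n
    have e : ∫⁻ y in cube (n + 1) x (2 ^ j), f y =
        ∫⁻ t in Ioo (x (Fin.last n) - 2 ^ j) (x (Fin.last n) + 2 ^ j),
          ∫⁻ y in cube n (Fin.init x) (2 ^ j), f (Fin.snoc y t) := by
      rw [← lintegral_indicator (cube_meas _ _ _), lintegral_snoc _ _ (hf.indicator (cube_meas _ _ _)),
        ← lintegral_indicator measurableSet_Ioo]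
      apply lintegral_congr; intro t
      by_cases ht : t ∈ Ioo (x (Fin.last n) - 2 ^ j) (x (Fin.last n) + 2 ^ j)
      · rw [indicator_of_mem ht, ← lintegral_indicator (cube_meas _ _ _)]
        apply lintegral_congr; intro y
        by_cases hy : y ∈ cube n (Fin.init x) (2 ^ j)
        · rw [indicator_of_mem ((cube_snoc _ _ _ _ _).2 ⟨hy, ht⟩), indicator_of_mem hy]
        · rw [indicator_of_notMem fun h => hy ((cube_snoc _ _ _ _ _).1 h).1, indicator_of_notMem hy]
      · rw [indicator_of_notMem ht]
        have : ∀ y : Fin n → ℝ, (cube (n + 1) x (2 ^ j)).indicator f (Fin.snoc y t) = 0 := fun y =>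
          indicator_of_notMem (fun h => ht ((cube_snoc _ _ _ _ _).1 h).2) _
        simp [this]
    have hfin : (ENNReal.ofReal (2 * 2 ^ j))⁻¹ ^ n ≠ ⊤ := by
      apply ENNReal.pow_ne_top
      rw [ENNReal.inv_ne_top]
      have : (0 : ℝ) < 2 * 2 ^ j := by positivity
      simpa using this
    rw [e, pow_succ', mul_assoc, ← lintegral_const_mul' _ _ hfin]
    simp only [SM]
    refine le_trans ?_ (A1_le_M1 j _ _)
    unfold A1
    gcongr with t
    exact ih (Fin.init x) _ (hf.comp (hms.comp (measurable_id.prodMk measurable_const)))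

theorem eball_meas (n : ℕ) (x : Fin n → ℝ) (r : ℝ) : MeasurableSet (eball n x r) := by
  unfold eball eudist
  apply measurableSet_lt _ measurable_const
  fun_prop

theorem eball_sub_cube (n : ℕ) (x : Fin n → ℝ) (r : ℝ) : eball n x r ⊆ cube n x r := by
  intro y hy i
  have hy' : Real.sqrt (∑ i, (x i - y i) ^ 2) < r := hy
  refine lt_of_le_of_lt ?_ hy'
  apply Real.le_sqrt_of_sq_le
  rw [sq_abs, ← neg_sub, neg_sq]
  exact Finset.single_le_sum (f := fun i => (x i - y i) ^ 2) (fun _ _ => sq_nonneg _)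
    (Finset.mem_univ i)

theorem cube_sub_eball (n : ℕ) (hn : 0 < n) (x : Fin n → ℝ) (r : ℝ) (hr : 0 < r) :
    cube n x (r / n) ⊆ eball n x r := by
  intro y hy
  change Real.sqrt (∑ i, (x i - y i) ^ 2) < r
  have hn' : (1 : ℝ) ≤ n := by exact_mod_cast hn
  rw [Real.sqrt_lt' hr]
  have : ∑ i, (x i - y i) ^ 2 < ∑ _i : Fin n, (r / n) ^ 2 := by
    apply Finset.sum_lt_sum_of_nonempty
    · exact ⟨⟨0, hn⟩, Finset.mem_univ _⟩
    · intro i _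
      have := hy i
      rw [← sq_abs, abs_sub_comm]
      exact pow_lt_pow_left₀ this (abs_nonneg _) (by norm_num)
  refine this.trans_le ?_
  simp only [Finset.sum_const, Finset.card_univ, Fintype.card_fin, nsmul_eq_mul]
  rw [div_pow, mul_div_assoc', div_le_iff₀ (by positivity)]
  nlinarith [mul_nonneg (mul_nonneg (sq_nonneg r) (by linarith : (0 : ℝ) ≤ n)) (sub_nonneg.2 hn')]

theorem mixedLnorm_fzero (n : ℕ) (q : Fin n → ℝ) (hq : ∀ i, 0 < q i) :
    mixedLnorm n q (fun _ => 0) = 0 := by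
  induction n with
  | zero => rfl
  | succ n ih =>
    rw [mixedLnorm_succ]
    simp only [ih (fun i => q i.castSucc) fun i => hq _]
    rw [ENNReal.zero_rpow_of_pos (hq _), lintegral_zero, ENNReal.zero_rpow_of_pos]
    exact one_div_pos.2 (hq _)

def RR (n : ℕ) (q : Fin n → ℝ) (r : ℝ) : ℝ≥0∞ := ∏ i, ENNReal.ofReal (2 * r) ^ (1 / q i)

theorem mixedLnorm_cube (n : ℕ) (q : Fin n → ℝ) (hq : ∀ i, 0 < q i) (x : Fin n → ℝ) (r : ℝ) :
    mixedLnorm n q ((cube n x r).indicator fun _ => 1) = RR n q r := by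
  unfold RR
  induction n with
  | zero =>
    rw [mixedLnorm_zero, indicator_of_mem]
    · simp
    · intro i; exact i.elim0
  | succ n ih =>
    rw [mixedLnorm_succ, Fin.prod_univ_castSucc, ← ih (fun i => q i.castSucc) (fun i => hq _) (Fin.init x)]
    set c := mixedLnorm n (fun i => q i.castSucc) ((cube n (Fin.init x) r).indicator fun _ => 1) with hc
    have hq0 := hq (Fin.last n)
    have : ∀ t, mixedLnorm n (fun i => q i.castSucc)
        (fun y => (cube (n + 1) x r).indicator (fun _ => 1) (Fin.snoc y t)) ^ q (Fin.last n) =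
        (Ioo (x (Fin.last n) - r) (x (Fin.last n) + r)).indicator (fun _ => c ^ q (Fin.last n)) t := by
      intro t
      by_cases ht : t ∈ Ioo (x (Fin.last n) - r) (x (Fin.last n) + r)
      · rw [indicator_of_mem ht, hc]
        congr 2
        ext y
        by_cases hy : y ∈ cube n (Fin.init x) r
        · rw [indicator_of_mem ((cube_snoc _ _ _ _ _).2 ⟨hy, ht⟩), indicator_of_mem hy]
        · rw [indicator_of_notMem fun h => hy ((cube_snoc _ _ _ _ _).1 h).1, indicator_of_notMem hy]
      · rw [indicator_of_notMem ht]
        have : ∀ y : Fin n → ℝ, (cube (n + 1) x r).indicator (fun _ => (1 : ℝ≥0∞)) (Fin.snoc y t) = 0 :=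
          fun y => indicator_of_notMem (fun h => ht ((cube_snoc _ _ _ _ _).1 h).2) _
        simp only [this]
        rw [mixedLnorm_fzero _ _ fun i => hq _, ENNReal.zero_rpow_of_pos hq0]
    simp only [this]
    rw [lintegral_indicator measurableSet_Ioo, setLIntegral_const, Real.volume_Ioo,
      ENNReal.mul_rpow_of_nonneg _ _ (by positivity), ← ENNReal.rpow_mul, mul_one_div_cancel hq0.ne',
      ENNReal.rpow_one]
    congr 3; ring

theorem RR_pos (n : ℕ) (q : Fin n → ℝ) (r : ℝ) (hr : 0 < r) : RR n q r ≠ 0 := by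
  unfold RR
  rw [Finset.prod_ne_zero_iff]
  intro i _
  have : 0 < ENNReal.ofReal (2 * r) := by simpa using hr
  exact (ENNReal.rpow_pos this ENNReal.ofReal_ne_top).ne'

theorem RR_fin (n : ℕ) (q : Fin n → ℝ) (r : ℝ) (hr : 0 < r) : RR n q r ≠ ⊤ := by
  unfold RR
  apply ENNReal.prod_ne_top
  intro i _
  have : 0 < ENNReal.ofReal (2 * r) := by simpa using hr
  exact ENNReal.rpow_ne_top_of_ne_zero this.ne' ENNReal.ofReal_ne_top

/-- The scaling factor of `RR`. -/
def sf (n : ℕ) (q : Fin n → ℝ) (a : ℝ) : ℝ≥0∞ := ∏ i, ENNReal.ofReal a ^ (1 / q i)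

theorem RR_scale (n : ℕ) (q : Fin n → ℝ) (a r : ℝ) (ha : 0 < a) (hr : 0 < r) :
    RR n q (a * r) = sf n q a * RR n q r := by
  unfold RR sf
  rw [← Finset.prod_mul_distrib]
  apply Finset.prod_congr rfl
  intro i _
  have : 0 < ENNReal.ofReal a := by simpa using ha
  rw [show 2 * (a * r) = a * (2 * r) by ring, ENNReal.ofReal_mul ha.le,
    ENNReal.mul_rpow_of_ne_top (by simp) ENNReal.ofReal_ne_top]

theorem sf_fin (n : ℕ) (q : Fin n → ℝ) (a : ℝ) (ha : 0 < a) : sf n q a ≠ ⊤ := by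
  have := RR_fin n q (a / 2) (by positivity)
  rwa [RR, show 2 * (a / 2) = a by ring] at this

def XB (n : ℕ) (q : Fin n → ℝ) (x : Fin n → ℝ) (r : ℝ) : ℝ≥0∞ :=
  mixedLnorm n q ((eball n x r).indicator fun _ => 1)

theorem mixedNorm_eq_XB (n : ℕ) (q : Fin n → ℝ) (x : Fin n → ℝ) (r : ℝ) :
    mixedNorm n q ((eball n x r).indicator fun _ => (1 : ℝ)) = XB n q x r := by
  unfold mixedNorm XB
  congr 1
  ext y
  by_cases hy : y ∈ eball n x r <;> simp [hy]

theorem XB_le (n : ℕ) (q : Fin n → ℝ) (hq : ∀ i, 0 < q i) (x : Fin n → ℝ) (r : ℝ) :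
    XB n q x r ≤ RR n q r := by
  rw [← mixedLnorm_cube n q hq x r]
  apply mixedLnorm_mono n q hq
  intro y
  exact indicator_le_indicator_of_subset (eball_sub_cube n x r) (fun _ => zero_le) y

theorem le_XB (n : ℕ) (hn : 0 < n) (q : Fin n → ℝ) (hq : ∀ i, 0 < q i) (x : Fin n → ℝ) (r : ℝ)
    (hr : 0 < r) : RR n q r ≤ sf n q n * XB n q x r := by
  have hn' : (0 : ℝ) < n := by exact_mod_cast hn
  have : r = n * (r / n) := by field_simp
  conv_lhs => rw [this]
  rw [RR_scale n q n (r / n) hn' (by positivity)]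
  gcongr
  rw [← mixedLnorm_cube n q hq x]
  apply mixedLnorm_mono n q hq
  intro y
  exact indicator_le_indicator_of_subset (cube_sub_eball n hn x r hr) (fun _ => zero_le) y

theorem XB_pos (n : ℕ) (hn : 0 < n) (q : Fin n → ℝ) (hq : ∀ i, 0 < q i) (x : Fin n → ℝ) (r : ℝ)
    (hr : 0 < r) : XB n q x r ≠ 0 := by
  intro h
  have := le_XB n hn q hq x r hr
  rw [h, mul_zero] at this
  exact RR_pos n q r hr (le_antisymm this zero_le)

theorem XB_fin (n : ℕ) (q : Fin n → ℝ) (hq : ∀ i, 0 < q i) (x : Fin n → ℝ) (r : ℝ)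
    (hr : 0 < r) : XB n q x r ≠ ⊤ :=
  ne_top_of_le_ne_top (RR_fin n q r hr) (XB_le n q hq x r)

theorem vol_eball (n : ℕ) (x : Fin n → ℝ) (r : ℝ) :
    volume (eball n x r) = XB n (fun _ => 1) x r := by
  unfold XB
  rw [mixedLnorm_one _ _ (measurable_const.indicator (eball_meas n x r)),
    lintegral_indicator (eball_meas n x r), setLIntegral_const, one_mul]

theorem RR_one (n : ℕ) (r : ℝ) : RR n (fun _ => 1) r = ENNReal.ofReal (2 * r) ^ n := by
  simp [RR]

theorem ball_avg_SM (n : ℕ) (hn : 0 < n) : ∃ C : ℝ≥0∞, C ≠ ⊤ ∧ ∀ (f : (Fin n → ℝ) → ℝ≥0∞)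
    (x : Fin n → ℝ) (r : ℝ), Measurable f → 0 < r →
    (volume (eball n x r))⁻¹ * ∫⁻ y in eball n x r, f y ≤ C * SM n f x := by
  have ones : ∀ i : Fin n, (0 : ℝ) < (fun _ => 1) i := fun _ => one_pos
  refine ⟨sf n (fun _ => 1) 2 * sf n (fun _ => 1) n, ?_, fun f x r hf hr => ?_⟩
  · exact ENNReal.mul_ne_top (sf_fin _ _ _ (by norm_num)) (sf_fin _ _ _ (by exact_mod_cast hn))
  obtain ⟨k, hk1, hk2⟩ := exists_mem_Ioc_zpow hr (show (1 : ℝ) < 2 by norm_num)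
  have hj : (2 : ℝ) ^ (k + 1) ≤ 2 * r := by
    rw [zpow_add_one₀ (by norm_num)]; linarith
  have hp : (0 : ℝ) < 2 ^ (k + 1) := by positivity
  have hp' : (0 : ℝ) < 2 * 2 ^ (k + 1) := by positivity
  have h1 := cube_avg n x (k + 1) f hf
  rw [vol_eball]
  set X := XB n (fun _ => 1) x r with hX
  have hX0 : X ≠ 0 := XB_pos n hn _ ones x r hr
  have hXt : X ≠ ⊤ := XB_fin n _ ones x r hr
  have h2 : ENNReal.ofReal (2 * 2 ^ (k + 1)) ^ n ≤
      sf n (fun _ => 1) 2 * sf n (fun _ => 1) n * X := by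
    calc ENNReal.ofReal (2 * 2 ^ (k + 1)) ^ n ≤ ENNReal.ofReal (2 * (2 * r)) ^ n := by gcongr
      _ = RR n (fun _ => 1) (2 * r) := (RR_one n _).symm
      _ = sf n (fun _ => 1) 2 * RR n (fun _ => 1) r := RR_scale _ _ _ _ (by norm_num) hr
      _ ≤ _ := by
        rw [mul_assoc]
        exact mul_le_mul_right (le_XB n hn _ ones x r hr) _
  have h3 : ∫⁻ y in eball n x r, f y ≤ ENNReal.ofReal (2 * 2 ^ (k + 1)) ^ n * SM n f x := by
    refine le_trans (lintegral_mono_set (t := cube n x (2 ^ (k + 1))) ?_) ?_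
    · refine (eball_sub_cube n x r).trans ?_
      intro y hy i
      exact (hy i).trans_le hk2
    · refine le_trans (le_of_eq ?_) (mul_le_mul_right h1 _)
      rw [← mul_assoc, ← mul_pow, ENNReal.mul_inv_cancel, one_pow, one_mul]
      · simpa using hp'
      · exact ENNReal.ofReal_ne_top
  calc X⁻¹ * ∫⁻ y in eball n x r, f y ≤ X⁻¹ * (ENNReal.ofReal (2 * 2 ^ (k + 1)) ^ n * SM n f x) := by
        gcongr
    _ ≤ X⁻¹ * (sf n (fun _ => 1) 2 * sf n (fun _ => 1) n * X * SM n f x) := by gcongr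
    _ = (X⁻¹ * X) * (sf n (fun _ => 1) 2 * sf n (fun _ => 1) n * SM n f x) := by ring
    _ = _ := by rw [ENNReal.inv_mul_cancel hX0 hXt, one_mul]

theorem mixed_holder (n m : ℕ) (Q : Fin m → Fin n → ℝ) (hQ : ∀ i j, 1 < Q i j)
    (q : Fin n → ℝ) (hq0 : ∀ j, 0 < q j) (hq : ∀ j, 1 / q j = ∑ i, 1 / Q i j)
    (g : Fin m → (Fin n → ℝ) → ℝ≥0∞) (hg : ∀ i, Measurable (g i)) :
    mixedLnorm n q (fun x => ∏ i, g i x) ≤ ∏ i, mixedLnorm n (Q i) (g i) := by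
  induction n with
  | zero => simp [mixedLnorm_zero]
  | succ n ih =>
    simp only [mixedLnorm_succ]
    have hr := hq0 (Fin.last n)
    set r := q (Fin.last n) with hrd
    have hms := measurable_snoc n
    have hfs : ∀ i, Measurable (Function.uncurry fun (t : ℝ) (y : Fin n → ℝ) => g i (Fin.snoc y t)) :=
      fun i => (hg i).comp (hms.comp measurable_swap)
    set h : Fin m → ℝ → ℝ≥0∞ := fun i t => mixedLnorm n (fun j => Q i j.castSucc)
      (fun y => g i (Fin.snoc y t)) with hh
    have hhm : ∀ i, Measurable (h i) := fun i => mixedLnorm_meas n _ ℝ _ (hfs i)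
    have hQ0 : ∀ i, 0 < Q i (Fin.last n) := fun i => by linarith [hQ i (Fin.last n)]
    have step : ∫⁻ t : ℝ, mixedLnorm n (fun i => q i.castSucc)
        (fun y => ∏ i, g i (Fin.snoc y t)) ^ r ≤
        ∏ i, (∫⁻ t, h i t ^ Q i (Fin.last n)) ^ (r / Q i (Fin.last n)) := by
      calc _ ≤ ∫⁻ t : ℝ, ∏ i, (h i t ^ Q i (Fin.last n)) ^ (r / Q i (Fin.last n)) := by
            apply lintegral_mono; intro t
            refine (ENNReal.rpow_le_rpow (ih (fun i j => Q i j.castSucc) (fun i j => hQ _ _) _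
              (fun j => hq0 _) (fun j => hq _) (fun i y => g i (Fin.snoc y t))
              (fun i => meas_section' _ (hfs i) t)) hr.le).trans (le_of_eq ?_)
            rw [← ENNReal.prod_rpow_of_nonneg hr.le]
            apply Finset.prod_congr rfl
            intro i _
            rw [← ENNReal.rpow_mul, mul_div_cancel₀ _ (hQ0 i).ne']
        _ ≤ _ := by
            apply ENNReal.lintegral_prod_norm_pow_le
            · intro i _
              exact ((hhm i).pow_const _).aemeasurable
            · have := hq (Fin.last n)
              have e : ∀ i, r / Q i (Fin.last n) = r * (1 / Q i (Fin.last n)) := fun i => by ring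
              simp only [e]
              rw [← Finset.mul_sum, ← this, mul_one_div_cancel hr.ne']
            · intro i _
              exact (div_pos hr (hQ0 i)).le
    refine (ENNReal.rpow_le_rpow step (by positivity)).trans (le_of_eq ?_)
    rw [← ENNReal.prod_rpow_of_nonneg (by positivity)]
    apply Finset.prod_congr rfl
    intro i _
    rw [← ENNReal.rpow_mul]
    congr 1
    field_simp

theorem prod_RR (n m : ℕ) (Q : Fin m → Fin n → ℝ)
    (q : Fin n → ℝ) (hq : ∀ j, 1 / q j = ∑ i, 1 / Q i j) (r : ℝ) (hr : 0 < r) :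
    ∏ i, RR n (Q i) r = RR n q r := by
  unfold RR
  rw [Finset.prod_comm]
  apply Finset.prod_congr rfl
  intro j _
  have h1 : ENNReal.ofReal (2 * r) ≠ 0 := by
    have : 0 < ENNReal.ofReal (2 * r) := by simpa using hr
    exact this.ne'
  rw [hq j]
  generalize (Finset.univ : Finset (Fin m)) = s
  classical
  induction s using Finset.induction with
  | empty => simp
  | insert a s ha ih =>
    rw [Finset.prod_insert ha, Finset.sum_insert ha, ih, ENNReal.rpow_add _ _ h1 ENNReal.ofReal_ne_top]

theorem mixedLnorm_smul (n : ℕ) (q : Fin n → ℝ) (hq : ∀ i, 0 < q i) (c : ℝ≥0∞)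
    (f : (Fin n → ℝ) → ℝ≥0∞) (hf : Measurable f) :
    mixedLnorm n q (fun x => c * f x) = c * mixedLnorm n q f := by
  induction n with
  | zero => rfl
  | succ n ih =>
    have hr := hq (Fin.last n)
    have hms := measurable_snoc n
    have hfs : Measurable (Function.uncurry fun (t : ℝ) (y : Fin n → ℝ) => f (Fin.snoc y t)) :=
      hf.comp (hms.comp measurable_swap)
    have hfn := mixedLnorm_meas n (fun i => q i.castSucc) ℝ _ hfs
    rw [mixedLnorm_succ, mixedLnorm_succ]
    have : ∀ t : ℝ, mixedLnorm n (fun i => q i.castSucc) (fun y => c * f (Fin.snoc y t)) =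
        c * mixedLnorm n (fun i => q i.castSucc) (fun y => f (Fin.snoc y t)) := fun t =>
      ih _ (fun i => hq _) _ (meas_section' _ hfs t)
    simp only [this]
    simp only [ENNReal.mul_rpow_of_nonneg _ _ hr.le]
    rw [lintegral_const_mul _ (hfn.pow_const _), ENNReal.mul_rpow_of_nonneg _ _ (by positivity),
      ← ENNReal.rpow_mul, mul_one_div_cancel hr.ne', ENNReal.rpow_one]

theorem eudist_eq (n : ℕ) (x y : Fin n → ℝ) :
    eudist n x y = dist (WithLp.toLp 2 x : EuclideanSpace ℝ (Fin n)) (WithLp.toLp 2 y) := by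
  rw [EuclideanSpace.dist_eq]
  simp [eudist, Real.dist_eq, sq_abs]

theorem eball_sub (n : ℕ) (x z : Fin n → ℝ) (r s t : ℝ) (hz : eudist n x z ≤ r) (h : r + s ≤ t) :
    eball n z s ⊆ eball n x t := by
  intro y hy
  have hy' : eudist n z y < s := hy
  change eudist n x y < t
  rw [eudist_eq] at *
  have := dist_triangle (WithLp.toLp 2 x : EuclideanSpace ℝ (Fin n)) (WithLp.toLp 2 z)
    (WithLp.toLp 2 y)
  linarith

theorem eudist_comm (n : ℕ) (x y : Fin n → ℝ) : eudist n x y = eudist n y x := by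
  rw [eudist_eq, eudist_eq, dist_comm]

theorem eudist_self (n : ℕ) (x : Fin n → ℝ) : eudist n x x = 0 := by
  rw [eudist_eq, dist_self]

theorem avg_cmp (n : ℕ) (hn : 0 < n) : ∃ C : ℝ≥0∞, C ≠ ⊤ ∧ ∀ (F : (Fin n → ℝ) → ℝ≥0∞)
    (z w : Fin n → ℝ) (r : ℝ), 0 < r → eball n z r ⊆ eball n w (2 * r) →
    (volume (eball n z r))⁻¹ * ∫⁻ y in eball n z r, F y ≤
      C * ((volume (eball n w (2 * r)))⁻¹ * ∫⁻ y in eball n w (2 * r), F y) := by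
  have ones : ∀ i : Fin n, (0 : ℝ) < (fun _ => 1) i := fun _ => one_pos
  refine ⟨sf n (fun _ => 1) 2 * sf n (fun _ => 1) n, ?_, fun F z w r hr hsub => ?_⟩
  · exact ENNReal.mul_ne_top (sf_fin _ _ _ (by norm_num)) (sf_fin _ _ _ (by exact_mod_cast hn))
  rw [vol_eball, vol_eball]
  set c := sf n (fun _ => 1) 2 * sf n (fun _ => 1) n
  set X := XB n (fun _ => 1) z r with hX
  set W := XB n (fun _ => 1) w (2 * r) with hW
  have hX0 : X ≠ 0 := XB_pos n hn _ ones z r hr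
  have hXt : X ≠ ⊤ := XB_fin n _ ones z r hr
  have hW0 : W ≠ 0 := XB_pos n hn _ ones w _ (by positivity)
  have hWt : W ≠ ⊤ := XB_fin n _ ones w _ (by positivity)
  have h1 : W ≤ c * X := by
    refine (XB_le n _ ones w _).trans ?_
    rw [RR_scale n _ 2 r (by norm_num) hr, mul_assoc]
    exact mul_le_mul_right (le_XB n hn _ ones z r hr) _
  have h2 : X⁻¹ ≤ c * W⁻¹ := by
    calc X⁻¹ = X⁻¹ * (W * W⁻¹) := by rw [ENNReal.mul_inv_cancel hW0 hWt, mul_one]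
      _ ≤ X⁻¹ * (c * X * W⁻¹) := by gcongr
      _ = (X⁻¹ * X) * (c * W⁻¹) := by ring
      _ = _ := by rw [ENNReal.inv_mul_cancel hX0 hXt, one_mul]
  rw [← mul_assoc]
  exact mul_le_mul' h2 (lintegral_mono_set hsub)

/-- The average over a ball is controlled by the mixed norm. -/
theorem avg_norm (n : ℕ) (hn : 0 < n) (q : Fin n → ℝ) (hq : ∀ i, 1 < q i) :
    ∃ C : ℝ≥0∞, C ≠ ⊤ ∧ ∀ (F : (Fin n → ℝ) → ℝ≥0∞) (x : Fin n → ℝ) (r : ℝ), Measurable F → 0 < r →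
    (volume (eball n x r))⁻¹ * (∫⁻ y in eball n x r, F y) * XB n q x r ≤
      C * mixedLnorm n q ((eball n x r).indicator F) := by
  obtain ⟨C1, hC1, h1⟩ := avg_cmp n hn
  obtain ⟨C2, hC2, h2⟩ := ball_avg_SM n hn
  obtain ⟨C3, hC3, h3⟩ := SM_bdd n q hq
  have hq0 : ∀ i, 0 < q i := fun i => by linarith [hq i]
  refine ⟨C1 * C2 * C3, by finiteness, fun F x r hF hr => ?_⟩
  set a := (volume (eball n x r))⁻¹ * ∫⁻ y in eball n x r, F y with ha
  have hB := eball_meas n x r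
  have hFB := hF.indicator hB
  have hSM : Measurable (SM n ((eball n x r).indicator F)) := by
    have := SM_measurable n Unit (fun _ => (eball n x r).indicator F) (hFB.comp measurable_snd)
    exact this.comp (f := fun y => ((), y)) ((measurable_const (a := ())).prodMk measurable_id)
  have hpt : ∀ z ∈ eball n x r, a ≤ C1 * C2 * SM n ((eball n x r).indicator F) z := by
    intro z hz
    have hz' : eudist n x z < r := hz
    have e : ∫⁻ y in eball n x r, F y = ∫⁻ y in eball n x r, (eball n x r).indicator F y :=
      setLIntegral_congr_fun hB fun y hy => by simp [hy]
    rw [ha, e]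
    refine (h1 _ x z r hr (eball_sub n z x r r (2 * r) ?_ (by linarith))).trans ?_
    · rw [eudist_comm]; exact hz'.le
    rw [mul_assoc]
    exact mul_le_mul_right (h2 _ z (2 * r) hFB (by positivity)) _
  calc a * XB n q x r = mixedLnorm n q (fun y => a * (eball n x r).indicator (fun _ => 1) y) :=
        (mixedLnorm_smul n q hq0 a _ (measurable_const.indicator hB)).symm
    _ ≤ mixedLnorm n q (fun y => C1 * C2 * SM n ((eball n x r).indicator F) y) := by
        apply mixedLnorm_mono n q hq0
        intro y
        by_cases hy : y ∈ eball n x r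
        · simpa [hy] using hpt y hy
        · simp [hy]
    _ = C1 * C2 * mixedLnorm n q (SM n ((eball n x r).indicator F)) :=
        mixedLnorm_smul n q hq0 _ _ hSM
    _ ≤ C1 * C2 * (C3 * mixedLnorm n q ((eball n x r).indicator F)) := by
        gcongr; exact h3 _ hFB
    _ = _ := by ring

theorem morrey_le (n : ℕ) (hn : 0 < n) (q : Fin n → ℝ) (hq : ∀ i, 0 < q i)
    (Φ : (Fin n → ℝ) → ℝ → ℝ) (hΦ : ∀ x r, 0 < r → 0 < Φ x r) (g : (Fin n → ℝ) → ℝ≥0∞)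
    (x : Fin n → ℝ) (r : ℝ) (hr : 0 < r) :
    mixedLnorm n q ((eball n x r).indicator g) ≤
      ENNReal.ofReal (Φ x r) * XB n q x r * morreyLnorm n q Φ g := by
  have h : (ENNReal.ofReal (Φ x r))⁻¹ * (XB n q x r)⁻¹ * mixedLnorm n q ((eball n x r).indicator g)
      ≤ morreyLnorm n q Φ g := by
    unfold morreyLnorm
    rw [← mixedNorm_eq_XB]
    exact le_iSup_of_le x (le_iSup₂_of_le r hr le_rfl)
  have hp : ENNReal.ofReal (Φ x r) ≠ 0 := by
    simpa using hΦ x r hr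
  have hX0 := XB_pos n hn q hq x r hr
  have hXt := XB_fin n q hq x r hr
  calc mixedLnorm n q ((eball n x r).indicator g)
      = (ENNReal.ofReal (Φ x r) * (ENNReal.ofReal (Φ x r))⁻¹) * (XB n q x r * (XB n q x r)⁻¹) *
        mixedLnorm n q ((eball n x r).indicator g) := by
        rw [ENNReal.mul_inv_cancel hp ENNReal.ofReal_ne_top, ENNReal.mul_inv_cancel hX0 hXt,
          one_mul, one_mul]
    _ = ENNReal.ofReal (Φ x r) * XB n q x r * ((ENNReal.ofReal (Φ x r))⁻¹ * (XB n q x r)⁻¹ *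
        mixedLnorm n q ((eball n x r).indicator g)) := by ring
    _ ≤ _ := by gcongr

theorem local_norm (n : ℕ) (hn : 0 < n) (q : Fin n → ℝ) (hq : ∀ i, 0 < q i)
    (Φ : (Fin n → ℝ) → ℝ → ℝ) (hΦ : ∀ x r, 0 < r → 0 < Φ x r) (g : (Fin n → ℝ) → ℝ≥0∞)
    (hfin : morreyLnorm n q Φ g ≠ ⊤) (x : Fin n → ℝ) (R : ℝ) (hR : 0 < R) :
    mixedLnorm n q ((eball n x R).indicator g) ≤
      2 * sf n q 2 * RR n q R * morreyLnorm n q Φ g *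
        ∫⁻ t in Ioi R, ENNReal.ofReal (Φ x t / t) := by
  set A := mixedLnorm n q ((eball n x R).indicator g) with hA
  set M := morreyLnorm n q Φ g with hM
  set S := sf n q 2 * RR n q R with hS
  have hSt : S * M ≠ ⊤ := by
    apply ENNReal.mul_ne_top _ hfin
    exact ENNReal.mul_ne_top (sf_fin n q 2 (by norm_num)) (RR_fin n q R hR)
  have hpt : ∀ t ∈ Ioo R (2 * R), A * ENNReal.ofReal (1 / (2 * R)) ≤
      S * M * ENNReal.ofReal (Φ x t / t) := by
    intro t ht
    have ht0 : 0 < t := hR.trans ht.1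
    have h1 : A ≤ ENNReal.ofReal (Φ x t) * S * M := by
      refine le_trans (mixedLnorm_mono n q hq _ _ ?_)
        ((morrey_le n hn q hq Φ hΦ g x t ht0).trans ?_)
      · intro y
        refine indicator_le_indicator_of_subset (eball_sub n x x 0 R t ?_ (by linarith [ht.1]))
          (fun _ => zero_le) y
        rw [eudist_self]
      · gcongr
        refine (XB_le n q hq x t).trans ?_
        rw [hS, ← RR_scale n q 2 R (by norm_num) hR]
        unfold RR
        gcongr with i
        · exact (one_div_pos.2 (hq i)).le
        · exact ht.2.le
    calc A * ENNReal.ofReal (1 / (2 * R)) ≤ (ENNReal.ofReal (Φ x t) * S * M) * ENNReal.ofReal (1 / t) := by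
          refine mul_le_mul' h1 (ENNReal.ofReal_le_ofReal ?_)
          exact one_div_le_one_div_of_le ht0 ht.2.le
      _ = S * M * (ENNReal.ofReal (Φ x t) * ENNReal.ofReal (1 / t)) := by ring
      _ = _ := by rw [← ENNReal.ofReal_mul (hΦ x t ht0).le, mul_one_div]
  have h2 : A * ENNReal.ofReal (1 / (2 * R)) * ENNReal.ofReal R ≤
      S * M * ∫⁻ t in Ioi R, ENNReal.ofReal (Φ x t / t) := by
    calc A * ENNReal.ofReal (1 / (2 * R)) * ENNReal.ofReal R
        = ∫⁻ t in Ioo R (2 * R), A * ENNReal.ofReal (1 / (2 * R)) := by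
          rw [setLIntegral_const, Real.volume_Ioo]; congr 2; ring
      _ ≤ ∫⁻ t in Ioo R (2 * R), S * M * ENNReal.ofReal (Φ x t / t) :=
          setLIntegral_mono' measurableSet_Ioo hpt
      _ ≤ ∫⁻ t in Ioi R, S * M * ENNReal.ofReal (Φ x t / t) :=
          lintegral_mono_set Ioo_subset_Ioi_self
      _ = _ := lintegral_const_mul' _ _ hSt
  have h3 : (2 : ℝ≥0∞) * (ENNReal.ofReal (1 / (2 * R)) * ENNReal.ofReal R) = 1 := by
    rw [show (2 : ℝ≥0∞) = ENNReal.ofReal 2 by simp, ← ENNReal.ofReal_mul (by positivity),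
      ← ENNReal.ofReal_mul (by norm_num)]
    rw [show 2 * (1 / (2 * R) * R) = 1 by field_simp]
    simp
  calc A = A * (2 * (ENNReal.ofReal (1 / (2 * R)) * ENNReal.ofReal R)) := by rw [h3, mul_one]
    _ = 2 * (A * ENNReal.ofReal (1 / (2 * R)) * ENNReal.ofReal R) := by ring
    _ ≤ 2 * (S * M * ∫⁻ t in Ioi R, ENNReal.ofReal (Φ x t / t)) := by gcongr
    _ = _ := by rw [hS]; ring

theorem single (n : ℕ) (hn : 0 < n) (q : Fin n → ℝ) (hq : ∀ i, 1 < q i) :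
    ∃ C : ℝ≥0∞, C ≠ ⊤ ∧ ∀ (Φ : (Fin n → ℝ) → ℝ → ℝ), (∀ x r, 0 < r → 0 < Φ x r) →
    ∀ g : (Fin n → ℝ) → ℝ≥0∞, Measurable g → morreyLnorm n q Φ g ≠ ⊤ →
    ∀ (x : Fin n → ℝ) (r : ℝ), 0 < r → ∃ G : (Fin n → ℝ) → ℝ≥0∞, Measurable G ∧
      (∀ z ∈ eball n x r, ∀ ρ, 0 < ρ →
        (volume (eball n z ρ))⁻¹ * ∫⁻ y in eball n z ρ, g y ≤ G z) ∧
      mixedLnorm n q G ≤ C * RR n q r * morreyLnorm n q Φ g *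
        ∫⁻ t in Ioi r, ENNReal.ofReal (Φ x t / t) := by
  obtain ⟨C1, hC1, h1⟩ := avg_cmp n hn
  obtain ⟨C2, hC2, h2⟩ := ball_avg_SM n hn
  obtain ⟨C3, hC3, h3⟩ := SM_bdd n q hq
  obtain ⟨C4, hC4, h4⟩ := avg_norm n hn q hq
  have hq0 : ∀ i, 0 < q i := fun i => by linarith [hq i]
  have s2 := sf_fin n q 2 (by norm_num)
  have sn := sf_fin n q n (by exact_mod_cast hn)
  set L := 2 * sf n q 2 with hL
  have hLt : L ≠ ⊤ := ENNReal.mul_ne_top (by simp) s2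
  refine ⟨C2 * C3 * L * sf n q 2 + C1 * C4 * L * sf n q n, by finiteness, ?_⟩
  intro Φ hΦ g hg hfin x r hr
  set M := morreyLnorm n q Φ g with hM
  set J : ℝ → ℝ≥0∞ := fun R => ∫⁻ t in Ioi R, ENNReal.ofReal (Φ x t / t) with hJ
  have hJm : ∀ R, r ≤ R → J R ≤ J r := fun R h => lintegral_mono_set (Ioi_subset_Ioi h)
  have hloc : ∀ R, 0 < R → mixedLnorm n q ((eball n x R).indicator g) ≤ L * RR n q R * M * J R :=
    fun R hR => local_norm n hn q hq0 Φ hΦ g hfin x R hR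
  set E := eball n x (2 * r) with hE
  have hEm : MeasurableSet E := eball_meas _ _ _
  have hBm := eball_meas n x r
  set c := C1 * C4 * L * sf n q n * M * J r with hc
  have hgE := hg.indicator hEm
  have hSM : Measurable (SM n (E.indicator g)) := by
    have := SM_measurable n Unit (fun _ => E.indicator g) (hgE.comp measurable_snd)
    exact this.comp (f := fun y => ((), y)) ((measurable_const (a := ())).prodMk measurable_id)
  have hB1 : Measurable ((eball n x r).indicator (fun _ => (1 : ℝ≥0∞))) :=
    measurable_const.indicator hBm
  refine ⟨fun z => C2 * SM n (E.indicator g) z + c * (eball n x r).indicator (fun _ => 1) z,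
    (hSM.const_mul _).add (hB1.const_mul _), ?_, ?_⟩
  · intro z hz ρ hρ
    have hz' : eudist n x z < r := hz
    by_cases hρr : ρ ≤ r
    · refine le_trans ?_ le_self_add
      refine le_trans (le_of_eq ?_) (h2 _ z ρ hgE hρ)
      congr 1
      apply setLIntegral_congr_fun (eball_meas _ _ _)
      intro y hy
      have hyE : y ∈ E := eball_sub n x z r ρ (2 * r) hz'.le (by linarith) hy
      simp [hyE]
    · push Not at hρr
      refine le_trans ?_ le_add_self
      rw [indicator_of_mem hz, mul_one]
      refine (h1 g z x ρ hρ (eball_sub n x z r ρ _ hz'.le (by linarith))).trans ?_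
      have h5 := h4 g x (2 * ρ) hg (by positivity)
      have hρ2 : 0 < 2 * ρ := by positivity
      have hX0 := XB_pos n hn q hq0 x (2 * ρ) hρ2
      have hXt := XB_fin n q hq0 x (2 * ρ) hρ2
      have h6 : (volume (eball n x (2 * ρ)))⁻¹ * (∫⁻ y in eball n x (2 * ρ), g y) *
          XB n q x (2 * ρ) ≤ (C4 * L * sf n q n * M * J r) * XB n q x (2 * ρ) := by
        refine h5.trans ?_
        calc _ ≤ C4 * (L * RR n q (2 * ρ) * M * J (2 * ρ)) := by gcongr; exact hloc _ hρ2
          _ ≤ C4 * (L * (sf n q n * XB n q x (2 * ρ)) * M * J r) := by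
              gcongr
              · exact le_XB n hn q hq0 x _ hρ2
              · exact hJm _ (by linarith)
          _ = _ := by ring
      rw [ENNReal.mul_le_mul_iff_left hX0 hXt] at h6
      calc _ ≤ C1 * (C4 * L * sf n q n * M * J r) := by gcongr
        _ = c := by rw [hc]; ring
  · have hgood := mixedLnorm_good n q fun i => (hq i).le
    calc _ ≤ mixedLnorm n q (fun z => C2 * SM n (E.indicator g) z) +
          mixedLnorm n q (fun z => c * (eball n x r).indicator (fun _ => 1) z) :=
          hgood.add _ _ (hSM.const_mul _) (hB1.const_mul _)
      _ = C2 * mixedLnorm n q (SM n (E.indicator g)) + c * XB n q x r := by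
          rw [mixedLnorm_smul n q hq0 _ _ hSM, mixedLnorm_smul n q hq0 _ _ hB1]; rfl
      _ ≤ C2 * (C3 * (L * (sf n q 2 * RR n q r) * M * J r)) + c * RR n q r := by
          have e1 := (h3 _ hgE).trans (mul_le_mul_right (hloc (2 * r) (by positivity)) C3)
          rw [RR_scale n q 2 r (by norm_num) hr] at e1
          have e2 : C3 * (L * (sf n q 2 * RR n q r) * M * J (2 * r)) ≤
              C3 * (L * (sf n q 2 * RR n q r) * M * J r) := by
            gcongr; exact hJm _ (by linarith)
          exact add_le_add (mul_le_mul_right (e1.trans e2) _)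
            (mul_le_mul_right (XB_le n q hq0 x r) _)
      _ = _ := by rw [hc]; ring

theorem final_thm (n m : ℕ) (hn : 0 < n) (hm : 2 ≤ m)
    (Q : Fin m → Fin n → ℝ) (hQ : ∀ i j, 1 < Q i j)
    (q : Fin n → ℝ) (hq : ∀ j, 1 / q j = ∑ i, 1 / Q i j)
    (φ : (Fin n → ℝ) → ℝ → ℝ) (Φ : Fin m → (Fin n → ℝ) → ℝ → ℝ)
    (hφpos : ∀ x r, 0 < r → 0 < φ x r)
    (hΦpos : ∀ i x r, 0 < r → 0 < Φ i x r)
    (C₀ : ℝ) (hC₀ : 0 < C₀)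
    (hcond : ∀ (x : Fin n → ℝ) (r : ℝ), 0 < r →
      (∏ i, ∫⁻ t in Set.Ioi r, ENNReal.ofReal (Φ i x t / t))
        ≤ ENNReal.ofReal (C₀ * φ x r)) :
    ∃ C : ℝ, 0 < C ∧ ∀ f : Fin m → ((Fin n → ℝ) → ℝ),
      (∀ i, Measurable (f i)) → (∀ i, morreyNorm n (Q i) (Φ i) (f i) ≠ ⊤) →
      morreyLnorm n q φ (multiMax n m f)
        ≤ ENNReal.ofReal C * ∏ i, morreyNorm n (Q i) (Φ i) (f i) := by
  have hq0 : ∀ j, 0 < q j := by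
    intro j
    have : 0 < 1 / q j := by
      rw [hq j]
      apply Finset.sum_pos
      · intro i _
        have := hQ i j
        positivity
      · exact ⟨⟨0, by omega⟩, Finset.mem_univ _⟩
    exact one_div_pos.1 this
  choose C hC hS using fun i => single n hn (Q i) (hQ i)
  set K : ℝ≥0∞ := (∏ i, C i) * sf n q n * ENNReal.ofReal C₀ with hK
  have hKt : K ≠ ⊤ := by
    apply ENNReal.mul_ne_top (ENNReal.mul_ne_top _ _) ENNReal.ofReal_ne_top
    · exact ENNReal.prod_ne_top fun i _ => hC i
    · exact sf_fin n q n (by exact_mod_cast hn)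
  refine ⟨K.toReal + 1, by positivity, fun f hf hfin => ?_⟩
  have hKle : K ≤ ENNReal.ofReal (K.toReal + 1) := by
    rw [ENNReal.le_ofReal_iff_toReal_le hKt (by positivity)]; linarith
  refine le_trans ?_ (mul_le_mul_left hKle _)
  unfold morreyLnorm
  refine iSup_le fun x => iSup₂_le fun r hr => ?_
  rw [mixedNorm_eq_XB]
  set F : Fin m → (Fin n → ℝ) → ℝ≥0∞ := fun i y => ENNReal.ofReal |f i y| with hF
  have hFm : ∀ i, Measurable (F i) := fun i =>
    ENNReal.measurable_ofReal.comp (continuous_abs.measurable.comp (hf i))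
  choose G hGm hGp hGn using fun i => hS i (Φ i) (hΦpos i) (F i) (hFm i) (hfin i) x r hr
  have hmain : mixedLnorm n q ((eball n x r).indicator (multiMax n m f)) ≤
      K * ENNReal.ofReal (φ x r) * XB n q x r * ∏ i, morreyNorm n (Q i) (Φ i) (f i) := by
    calc _ ≤ mixedLnorm n q (fun z => ∏ i, G i z) := by
          apply mixedLnorm_mono n q hq0
          intro z
          by_cases hz : z ∈ eball n x r
          · rw [indicator_of_mem hz]
            refine iSup₂_le fun ρ hρ => ?_
            exact Finset.prod_le_prod' fun i _ => hGp i z hz ρ hρ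
          · rw [indicator_of_notMem hz]; exact zero_le
      _ ≤ ∏ i, mixedLnorm n (Q i) (G i) := mixed_holder n m Q hQ q hq0 hq G hGm
      _ ≤ ∏ i, (C i * RR n (Q i) r * morreyNorm n (Q i) (Φ i) (f i) *
            ∫⁻ t in Ioi r, ENNReal.ofReal (Φ i x t / t)) :=
          Finset.prod_le_prod' fun i _ => hGn i
      _ = (∏ i, C i) * RR n q r * (∏ i, morreyNorm n (Q i) (Φ i) (f i)) *
            ∏ i, ∫⁻ t in Ioi r, ENNReal.ofReal (Φ i x t / t) := by
          rw [Finset.prod_mul_distrib, Finset.prod_mul_distrib, Finset.prod_mul_distrib,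
            prod_RR n m Q q hq r hr]
      _ ≤ (∏ i, C i) * (sf n q n * XB n q x r) * (∏ i, morreyNorm n (Q i) (Φ i) (f i)) *
            ENNReal.ofReal (C₀ * φ x r) :=
          mul_le_mul' (mul_le_mul_left (mul_le_mul_right (le_XB n hn q hq0 x r hr) _) _)
            (hcond x r hr)
      _ = _ := by rw [ENNReal.ofReal_mul hC₀.le, hK]; ring
  have hp : ENNReal.ofReal (φ x r) ≠ 0 := by
    simpa using hφpos x r hr
  have hX0 := XB_pos n hn q hq0 x r hr
  have hXt := XB_fin n q hq0 x r hr
  calc _ ≤ (ENNReal.ofReal (φ x r))⁻¹ * (XB n q x r)⁻¹ *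
        (K * ENNReal.ofReal (φ x r) * XB n q x r * ∏ i, morreyNorm n (Q i) (Φ i) (f i)) :=
        mul_le_mul_right hmain _
    _ = ((ENNReal.ofReal (φ x r))⁻¹ * ENNReal.ofReal (φ x r)) * ((XB n q x r)⁻¹ * XB n q x r) *
        (K * ∏ i, morreyNorm n (Q i) (Φ i) (f i)) := by ring
    _ = _ := by
        rw [ENNReal.inv_mul_cancel hp ENNReal.ofReal_ne_top, ENNReal.inv_mul_cancel hX0 hXt,
          one_mul, one_mul]

theorem stmt16 (n m : ℕ) (hn : 0 < n) (hm : 2 ≤ m)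
    (Q : Fin m → Fin n → ℝ) (hQ : ∀ i j, 1 < Q i j)
    (q : Fin n → ℝ) (hq : ∀ j, 1 / q j = ∑ i, 1 / Q i j)
    (φ : (Fin n → ℝ) → ℝ → ℝ) (Φ : Fin m → (Fin n → ℝ) → ℝ → ℝ)
    (hφmeas : Measurable fun p : (Fin n → ℝ) × ℝ => φ p.1 p.2)
    (hΦmeas : ∀ i, Measurable fun p : (Fin n → ℝ) × ℝ => Φ i p.1 p.2)
    (hφpos : ∀ x r, 0 < r → 0 < φ x r)
    (hΦpos : ∀ i x r, 0 < r → 0 < Φ i x r)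
    (C₀ : ℝ) (hC₀ : 0 < C₀)
    (hcond : ∀ (x : Fin n → ℝ) (r : ℝ), 0 < r →
      (∏ i, ∫⁻ t in Set.Ioi r, ENNReal.ofReal (Φ i x t / t))
        ≤ ENNReal.ofReal (C₀ * φ x r)) :
    ∃ C : ℝ, 0 < C ∧ ∀ f : Fin m → ((Fin n → ℝ) → ℝ),
      (∀ i, Measurable (f i)) → (∀ i, morreyNorm n (Q i) (Φ i) (f i) ≠ ⊤) →
      morreyLnorm n q φ (multiMax n m f)
        ≤ ENNReal.ofReal C * ∏ i, morreyNorm n (Q i) (Φ i) (f i) := by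
  exact final_thm n m hn hm Q hQ q hq φ Φ hφpos hΦpos C₀ hC₀ hcond
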